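/- Let k ≥ 1 be a constant integer and suppose K_n → ∞, K_n²/P_n → 0, and p_{e,q}(n) = (ln n + (k−1)·ln ln n + b·ln ln n + β_n)/n, where b is a constant integer with k + b ≥ 1 and the real sequence β_n satisfies −1 < liminf_{n→∞} β_n/ln ln n ≤ limsup_{n→∞} β_n/ln ln n < 1. If β_n → +∞, then the probability that the minimum degree δ_n of 𝔾_q(n,K_n,P_n,p_n) equals k+b converges to 1 as n → ∞. -/

import Mathlib

open Finset Filter

/-- A configuration of the random graph `𝔾_q(n,K,P,p)`: a key-ring assignment
(one finite subset of the key pool `Fin P` per vertex) together with the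
on/off states of the channels (one Boolean per unordered pair of vertices). -/
abbrev Config (n P : ℕ) : Type := (Fin n → Finset (Fin P)) × (Sym2 (Fin n) → Bool)

/-- Probability weight of a configuration: the key rings are independent and
uniform over the `K`-element subsets of the pool of size `P`, and the channels
are independent Bernoulli(`p`). -/
noncomputable def weight (n K P : ℕ) (p : ℝ) (ω : Config n P) : ℝ :=
  (∏ i : Fin n, if (ω.1 i).card = K then ((P.choose K : ℝ))⁻¹ else 0) *
  (∏ e : Sym2 (Fin n), if ω.2 e then p else 1 - p)

/-- Probability of an event in `𝔾_q(n,K,P,p)`. -/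
noncomputable def prob (n K P : ℕ) (p : ℝ) (E : Set (Config n P)) : ℝ :=
  ∑ ω : Config n P, Set.indicator E (weight n K P p) ω

/-- Adjacency in `𝔾_q(n,K,P,p)`: two distinct vertices are adjacent iff their
key rings share at least `q` keys and the channel between them is on. -/
def Adj (q n P : ℕ) (ω : Config n P) (i j : Fin n) : Prop :=
  i ≠ j ∧ q ≤ ((ω.1 i) ∩ (ω.1 j)).card ∧ ω.2 s(i, j) = true

/-- Degree of a vertex. -/
noncomputable def degree (q n P : ℕ) (ω : Config n P) (i : Fin n) : ℕ :=
  Nat.card {j : Fin n // Adj q n P ω i j}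

/-- Minimum degree of the graph. -/
noncomputable def minDeg (q n P : ℕ) (ω : Config n P) : ℕ :=
  sInf (Set.range fun i => degree q n P ω i)

/-- `p_{s,q}`: the probability that two key rings share at least `q` keys. -/
noncomputable def psq (q K P : ℕ) : ℝ :=
  1 - ∑ u ∈ Finset.range q,
    ((K.choose u : ℝ) * ((P - K).choose (K - u) : ℝ)) / (P.choose K : ℝ)

/-- `p_{e,q}`: the probability that two distinct vertices are adjacent. -/
noncomputable def peq (q K P : ℕ) (p : ℝ) : ℝ := p * psq q K P

/-- Probability that a uniform `K`-subset of `Fin P` equals `V`. -/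
noncomputable def ringW {P : ℕ} (K : ℕ) (V : Finset (Fin P)) : ℝ :=
  if V.card = K then ((P.choose K : ℝ))⁻¹ else 0

/-- Expectation of a function of a uniform `K`-subset of `Fin P`. -/
noncomputable def ringE {P : ℕ} (K : ℕ) (f : Finset (Fin P) → ℝ) : ℝ :=
  ∑ V, ringW K V * f V

/-- Probability that a uniform `K`-subset of `Fin P` contains a given `j`-subset. -/
noncomputable def inclProb (K P j : ℕ) : ℝ := (K.choose j : ℝ) / (P.choose j : ℝ)

section Rings

variable {K P : ℕ}

lemma ringW_nonneg (V : Finset (Fin P)) : 0 ≤ ringW K V := by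
  unfold ringW; split_ifs <;> positivity

lemma ringE_eq (f : Finset (Fin P) → ℝ) :
    ringE K f = (P.choose K : ℝ)⁻¹ * ∑ V ∈ powersetCard K univ, f V := by
  have : powersetCard K (univ : Finset (Fin P)) = univ.filter fun V => V.card = K := by
    ext; simp [mem_powersetCard]
  rw [this, mul_sum, sum_filter]
  unfold ringE ringW
  exact sum_congr rfl fun V _ => by split_ifs <;> simp

lemma ringE_mono {f g : Finset (Fin P) → ℝ} (h : ∀ V, V.card = K → f V ≤ g V) :
    ringE K f ≤ ringE K g := by
  rw [ringE_eq, ringE_eq]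
  gcongr with V hV
  exact h V (mem_powersetCard.1 hV).2

lemma ringE_congr {f g : Finset (Fin P) → ℝ} (h : ∀ V, V.card = K → f V = g V) :
    ringE K f = ringE K g :=
  le_antisymm (ringE_mono fun V hV => (h V hV).le) (ringE_mono fun V hV => (h V hV).ge)

lemma ringE_const (hKP : K ≤ P) (c : ℝ) : ringE K (fun _ : Finset (Fin P) => c) = c := by
  have : (P.choose K : ℝ) ≠ 0 := by exact_mod_cast (Nat.choose_pos hKP).ne'
  rw [ringE_eq]; simp; field_simp

lemma ringE_sum {ι : Type*} (s : Finset ι) (f : ι → Finset (Fin P) → ℝ) :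
    ringE K (fun V => ∑ i ∈ s, f i V) = ∑ i ∈ s, ringE K (f i) := by
  unfold ringE
  simp_rw [mul_sum]
  exact sum_comm

lemma ringE_add (f g : Finset (Fin P) → ℝ) :
    ringE K (fun V => f V + g V) = ringE K f + ringE K g := by
  unfold ringE
  simp_rw [mul_add, sum_add_distrib]

lemma ringE_mul_left (c : ℝ) (f : Finset (Fin P) → ℝ) :
    ringE K (fun V => c * f V) = c * ringE K f := by
  unfold ringE
  simp_rw [mul_sum, mul_left_comm]

lemma ringE_sub (f g : Finset (Fin P) → ℝ) :
    ringE K (fun V => f V - g V) = ringE K f - ringE K g := by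
  unfold ringE
  simp_rw [mul_sub, sum_sub_distrib]

lemma ringE_nonneg {f : Finset (Fin P) → ℝ} (h : ∀ V, 0 ≤ f V) : 0 ≤ ringE K f :=
  sum_nonneg fun V _ => mul_nonneg (ringW_nonneg V) (h V)

lemma inclProb_nonneg (j : ℕ) : 0 ≤ inclProb K P j := by unfold inclProb; positivity

lemma ringE_subset (hKP : K ≤ P) (Q : Finset (Fin P)) :
    ringE K (fun V => if Q ⊆ V then 1 else 0) = inclProb K P Q.card := by
  rw [ringE_eq, sum_boole, inclProb]
  rcases le_or_gt Q.card K with hQ | hQ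
  · rw [card_filter_powersetCard_subset Q univ K (subset_univ _) hQ, card_univ, Fintype.card_fin]
    have h1 : (P.choose K : ℝ) * K.choose Q.card
        = P.choose Q.card * (P - Q.card).choose (K - Q.card) := by
      exact_mod_cast Nat.choose_mul (n := P) hQ
    have h2 : (P.choose K : ℝ) ≠ 0 := by exact_mod_cast (Nat.choose_pos hKP).ne'
    have h3 : (P.choose Q.card : ℝ) ≠ 0 := by exact_mod_cast (Nat.choose_pos (hQ.trans hKP)).ne'
    rw [inv_mul_eq_div, div_eq_div_iff h2 h3]
    linear_combination -h1
  · rw [Nat.choose_eq_zero_of_lt hQ, filter_false_of_mem]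
    · simp
    · intro V hV hQV
      have := card_le_card hQV
      rw [(mem_powersetCard.1 hV).2] at this
      omega

lemma inclProb_succ_mul {j : ℕ} (hj : j < P) :
    inclProb K P (j + 1) * (P - j) = inclProb K P j * ((K - j : ℕ) : ℝ) := by
  have h1 : ((K.choose (j + 1) : ℝ)) * (j + 1) = K.choose j * ((K - j : ℕ) : ℝ) := by
    exact_mod_cast Nat.choose_succ_right_eq K j
  have h2 : ((P.choose (j + 1) : ℝ)) * (j + 1) = P.choose j * (P - j) := by
    have := Nat.choose_succ_right_eq P j
    rw [← Nat.cast_sub hj.le]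
    exact_mod_cast this
  have h3 : (P.choose (j + 1) : ℝ) ≠ 0 := by exact_mod_cast (Nat.choose_pos hj).ne'
  have h4 : (P.choose j : ℝ) ≠ 0 := by exact_mod_cast (Nat.choose_pos hj.le).ne'
  have h5 : (j + 1 : ℝ) ≠ 0 := by positivity
  unfold inclProb
  rw [div_mul_eq_mul_div, div_mul_eq_mul_div, div_eq_div_iff h3 h4]
  apply mul_right_cancel₀ h5
  linear_combination ((P : ℝ) - j) * P.choose j * h1 - K.choose j * ((K - j : ℕ) : ℝ) * h2

lemma inclProb_eq_zero {j : ℕ} (hj : K < j) : inclProb K P j = 0 := by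
  simp [inclProb, Nat.choose_eq_zero_of_lt hj]

lemma inclProb_add_le (hKP : K ≤ P) (i j : ℕ) :
    inclProb K P (i + j) ≤ inclProb K P i * inclProb K P j := by
  induction j with
  | zero => simp [inclProb]
  | succ j ih =>
    rcases lt_or_ge K (i + (j + 1)) with h | h
    · rw [inclProb_eq_zero h]
      exact mul_nonneg (inclProb_nonneg _) (inclProb_nonneg _)
    · have e1 := inclProb_succ_mul (K := K) (P := P) (j := i + j) (by omega)
      have e2 := inclProb_succ_mul (K := K) (P := P) (j := j) (by omega)
      rw [Nat.cast_sub (by omega)] at e1 e2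
      push_cast at e1 e2
      have hKP' : (K : ℝ) ≤ P := by exact_mod_cast hKP
      have h' : (i : ℝ) + j + 1 ≤ K := by exact_mod_cast h
      have hi : (0 : ℝ) ≤ i := by positivity
      have hj : (0 : ℝ) ≤ j := by positivity
      have p1 : (0 : ℝ) < P - (i + j) := by linarith
      have p2 : (0 : ℝ) < P - j := by linarith
      have a1 : inclProb K P (i + j + 1) = inclProb K P (i + j) * ((K - (i + j)) / (P - (i + j))) := by
        rw [mul_div_assoc', eq_div_iff p1.ne', e1]
      have a2 : inclProb K P (j + 1) = inclProb K P j * ((K - j) / (P - j)) := by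
        rw [mul_div_assoc', eq_div_iff p2.ne', e2]
      rw [← add_assoc, a1, a2, ← mul_assoc]
      have hfrac : ((K : ℝ) - (i + j)) / (P - (i + j)) ≤ (K - j) / (P - j) := by
        rw [div_le_div_iff₀ p1 p2]; nlinarith
      have : (0 : ℝ) ≤ (K - (i + j)) / (P - (i + j)) := div_nonneg (by linarith) p1.le
      exact mul_le_mul ih hfrac this (mul_nonneg (inclProb_nonneg _) (inclProb_nonneg _))

lemma inclProb_one : inclProb K P 1 = K / P := by simp [inclProb]

lemma inclProb_le_pow (hKP : K ≤ P) (j : ℕ) : inclProb K P j ≤ ((K : ℝ) / P) ^ j := by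
  induction j with
  | zero => simp [inclProb]
  | succ j ih =>
    refine (inclProb_add_le hKP j 1).trans ?_
    rw [inclProb_one, pow_succ]
    gcongr

lemma ringE_inter_card {T : Finset (Fin P)} (hT : T.card = K) (u : ℕ) :
    ringE K (fun V => if (T ∩ V).card = u then 1 else 0)
      = ((K.choose u : ℝ) * ((P - K).choose (K - u) : ℝ)) / (P.choose K : ℝ) := by
  rw [ringE_eq, sum_boole, inv_mul_eq_div]
  congr 1
  have hc : #((powersetCard K univ).filter fun V => (T ∩ V).card = u)
      = #(powersetCard u T ×ˢ powersetCard (K - u) Tᶜ) := by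
    refine card_nbij' (fun V => (T ∩ V, V \ T)) (fun x => x.1 ∪ x.2) ?_ ?_ ?_ ?_
    · intro V hV
      simp only [coe_filter, mem_powersetCard, subset_univ, true_and, Set.mem_ofPred_eq] at hV
      simp only [coe_product, Set.mem_prod, mem_coe, mem_powersetCard, inter_subset_left, hV.2,
        true_and]
      refine ⟨fun x hx => by simpa using (Finset.mem_sdiff.1 hx).2, ?_⟩
      have := card_sdiff_add_card_inter V T
      rw [inter_comm, hV.2, hV.1] at this
      omega
    · rintro ⟨A, B⟩ h
      simp only [coe_product, Set.mem_prod, mem_coe, mem_powersetCard] at h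
      obtain ⟨⟨hA, hAc⟩, hB, hBc⟩ := h
      have hd : Disjoint T B := by
        rw [← subset_compl_iff_disjoint_left]; exact hB
      have hu : u ≤ K := by rw [← hAc, ← hT]; exact card_le_card hA
      simp only [coe_filter, mem_powersetCard, subset_univ, true_and, Set.mem_ofPred_eq]
      rw [card_union_of_disjoint (hd.mono_left hA), inter_union_distrib_left,
        disjoint_iff_inter_eq_empty.1 hd, union_empty, inter_eq_right.2 hA]
      omega
    · intro V _
      ext x
      simp only [mem_union, mem_inter, Finset.mem_sdiff]
      tauto
    · rintro ⟨A, B⟩ h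
      simp only [coe_product, Set.mem_prod, mem_coe, mem_powersetCard] at h
      obtain ⟨⟨hA, -⟩, hB, -⟩ := h
      have hB' : ∀ x ∈ B, x ∉ T := fun x hx => mem_compl.1 (hB hx)
      ext x
      · simp only [mem_inter, mem_union]
        exact ⟨fun h => h.2.resolve_right fun hx => hB' x hx h.1, fun h => ⟨hA h, Or.inl h⟩⟩
      · simp only [Finset.mem_sdiff, mem_union]
        exact ⟨fun h => h.1.resolve_left fun hx => h.2 (hA hx), fun h => ⟨Or.inr h, hB' x h⟩⟩
  rw [hc, card_product, card_powersetCard, card_powersetCard, hT, card_compl,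
    hT, Fintype.card_fin, Nat.cast_mul]

lemma psq_eq (hKP : K ≤ P) (q : ℕ) {T : Finset (Fin P)} (hT : T.card = K) :
    psq q K P = ringE K (fun V => if q ≤ (T ∩ V).card then 1 else 0) := by
  unfold psq
  simp_rw [← ringE_inter_card hT]
  rw [← ringE_sum]
  nth_rewrite 1 [← ringE_const hKP 1]
  rw [← ringE_sub]
  refine ringE_congr fun V _ => ?_
  simp only [sum_ite_eq, mem_range]
  split_ifs <;> first | omega | norm_num

lemma sum_powersetCard_subset_boole (T V : Finset (Fin P)) (j : ℕ) :
    ∑ Q ∈ powersetCard j T, (if Q ⊆ V then (1 : ℝ) else 0) = (T ∩ V).card.choose j := by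
  rw [sum_boole, ← card_powersetCard]
  congr 2
  ext Q
  simp only [mem_filter, mem_powersetCard, subset_inter_iff]
  tauto

lemma ringE_choose_inter (hKP : K ≤ P) (T : Finset (Fin P)) (j : ℕ) :
    ringE K (fun V => ((T ∩ V).card.choose j : ℝ)) = T.card.choose j * inclProb K P j := by
  simp_rw [← sum_powersetCard_subset_boole]
  rw [ringE_sum]
  simp_rw [ringE_subset hKP]
  rw [sum_powersetCard, nsmul_eq_mul]

lemma choose_sub_le_boole (w q : ℕ) :
    (w.choose q : ℝ) - (q + 1) * w.choose (q + 1) ≤ if q ≤ w then 1 else 0 := by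
  have h1 : ((w.choose (q + 1) : ℝ)) * (q + 1) = w.choose q * ((w - q : ℕ) : ℝ) := by
    exact_mod_cast Nat.choose_succ_right_eq w q
  split_ifs with h
  · rcases h.eq_or_lt with rfl | h'
    · simp
    · have : (1 : ℝ) ≤ ((w - q : ℕ) : ℝ) := by exact_mod_cast (by omega : 1 ≤ w - q)
      have h0 : (0 : ℝ) ≤ w.choose q := by positivity
      nlinarith
  · simp [Nat.choose_eq_zero_of_lt (not_le.1 h), Nat.choose_eq_zero_of_lt
      (show w < q + 1 by omega)]

lemma le_psq (hKP : K ≤ P) (q : ℕ) :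
    K.choose q * inclProb K P q * (1 - (K : ℝ) ^ 2 / P) ≤ psq q K P := by
  obtain ⟨T, hT⟩ : ∃ T : Finset (Fin P), T.card = K := by
    obtain ⟨T, -, hT⟩ := exists_subset_card_eq (s := (univ : Finset (Fin P))) (n := K)
      (by simpa using hKP)
    exact ⟨T, hT⟩
  rw [psq_eq hKP q hT]
  refine le_trans ?_ (ringE_mono fun V _ => choose_sub_le_boole (T ∩ V).card q)
  rw [ringE_sub, ringE_mul_left, ringE_choose_inter hKP, ringE_choose_inter hKP, hT]
  have h1 : ((K.choose (q + 1) : ℝ)) * (q + 1) = K.choose q * ((K - q : ℕ) : ℝ) := by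
    exact_mod_cast Nat.choose_succ_right_eq K q
  have h2 : inclProb K P (q + 1) ≤ inclProb K P q * (K / P) := by
    simpa [inclProb_one] using inclProb_add_le hKP q 1
  have h3 : ((K - q : ℕ) : ℝ) ≤ K := by exact_mod_cast Nat.sub_le K q
  have h4 : (K.choose (q + 1) * (q + 1) : ℝ) * inclProb K P (q + 1)
      ≤ (K.choose q * K) * (inclProb K P q * (K / P)) := by
    rw [h1]
    gcongr
    exact inclProb_nonneg _
  have e : (K.choose q * inclProb K P q * (1 - (K : ℝ) ^ 2 / P))
      = K.choose q * inclProb K P q - (K.choose q * K) * (inclProb K P q * (K / P)) := by ring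
  rw [e]
  linarith

lemma ringE_exp_inter (hKP : K ≤ P) {T : Finset (Fin P)} (hT : T.card = K) {l : ℝ}
    (hl : 0 ≤ l) :
    ringE K (fun V => Real.exp (l * (T ∩ V).card))
      ≤ Real.exp ((Real.exp l - 1) * ((K : ℝ) ^ 2 / P)) := by
  have h0 : 0 ≤ Real.exp l - 1 := by linarith [Real.add_one_le_exp l]
  have e : ∀ V : Finset (Fin P), Real.exp (l * (T ∩ V).card)
      = ∑ Q ∈ T.powerset, (Real.exp l - 1) ^ Q.card * (if Q ⊆ V then 1 else 0) := by
    intro V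
    have := Finset.sum_pow_mul_eq_add_pow (Real.exp l - 1) 1 (T ∩ V)
    rw [sub_add_cancel, ← Real.exp_nat_mul, mul_comm] at this
    rw [← this]
    simp only [one_pow, mul_one, mul_ite, mul_zero]
    rw [← sum_filter]
    refine sum_congr ?_ fun _ _ => rfl
    ext Q
    simp only [mem_filter, mem_powerset, subset_inter_iff]
  simp_rw [e]
  rw [ringE_sum]
  simp_rw [ringE_mul_left, ringE_subset hKP]
  calc ∑ Q ∈ T.powerset, (Real.exp l - 1) ^ Q.card * inclProb K P Q.card
      ≤ ∑ Q ∈ T.powerset, ((Real.exp l - 1) * (K / P)) ^ Q.card * 1 ^ (T.card - Q.card) := by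
        refine sum_le_sum fun Q _ => ?_
        rw [mul_pow, one_pow, mul_one]
        gcongr
        exact inclProb_le_pow hKP _
    _ = ((Real.exp l - 1) * (K / P) + 1) ^ K := by rw [Finset.sum_pow_mul_eq_add_pow, hT]
    _ ≤ (Real.exp ((Real.exp l - 1) * (K / P))) ^ K := by
        gcongr
        exact Real.add_one_le_exp _
    _ = _ := by rw [← Real.exp_nat_mul]; congr 1; ring

lemma boole_inter_le (q : ℕ) (hq : 1 ≤ q) (T U V : Finset (Fin P)) :
    ((if q ≤ (T ∩ V).card then (1 : ℝ) else 0) * if q ≤ (U ∩ V).card then 1 else 0)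
      ≤ (∑ z ∈ T ∩ U, ∑ Q ∈ powersetCard q T with z ∈ Q, if Q ⊆ V then 1 else 0)
        + ∑ Q ∈ powersetCard q T, ∑ R ∈ powersetCard q U,
          if Disjoint Q R ∧ Q ∪ R ⊆ V then 1 else 0 := by
  have n1 : (0 : ℝ) ≤ ∑ z ∈ T ∩ U, ∑ Q ∈ powersetCard q T with z ∈ Q, if Q ⊆ V then 1 else 0 :=
    sum_nonneg fun _ _ => sum_nonneg fun _ _ => by split_ifs <;> norm_num
  have n2 : ∀ Q, (0 : ℝ) ≤ ∑ R ∈ powersetCard q U, if Disjoint Q R ∧ Q ∪ R ⊆ V then 1 else 0 :=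
    fun _ => sum_nonneg fun _ _ => by split_ifs <;> norm_num
  have n3 := sum_nonneg fun Q (_ : Q ∈ powersetCard q T) => n2 Q
  rcases lt_or_ge (T ∩ V).card q with hT | hT
  · rw [if_neg (not_le.2 hT)]; linarith
  rcases lt_or_ge (U ∩ V).card q with hU | hU
  · rw [if_neg (not_le.2 hU)]; linarith
  rw [if_pos hT, if_pos hU, one_mul]
  rcases (T ∩ U ∩ V).eq_empty_or_nonempty with h | ⟨z, hz⟩
  · obtain ⟨Q, hQ, hQc⟩ := exists_subset_card_eq hT
    obtain ⟨R, hR, hRc⟩ := exists_subset_card_eq hU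
    rw [subset_inter_iff] at hQ hR
    have hd : Disjoint Q R := by
      rw [disjoint_left]
      intro x hx hx'
      have : x ∈ T ∩ U ∩ V := by simp [hQ.1 hx, hR.1 hx', hQ.2 hx]
      simp [h] at this
    have s1 := single_le_sum (f := fun R => if Disjoint Q R ∧ Q ∪ R ⊆ V then (1 : ℝ) else 0)
      (fun _ _ => by positivity) (mem_powersetCard.2 ⟨hR.1, hRc⟩)
    have s2 := single_le_sum (f := fun Q => ∑ R ∈ powersetCard q U,
      if Disjoint Q R ∧ Q ∪ R ⊆ V then (1 : ℝ) else 0)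
      (fun Q _ => n2 Q) (mem_powersetCard.2 ⟨hQ.1, hQc⟩)
    simp only [hd, union_subset hQ.2 hR.2, and_self, if_true] at s1
    linarith
  · simp only [mem_inter] at hz
    obtain ⟨Q, hzQ, hQ, hQc⟩ := exists_subsuperset_card_eq
      (s := {z}) (t := T ∩ V) (n := q) (by simp [hz]) (by simpa using hq) hT
    rw [subset_inter_iff] at hQ
    have s1 := single_le_sum (s := (powersetCard q T).filter (z ∈ ·))
      (f := fun Q => if Q ⊆ V then (1 : ℝ) else 0) (fun _ _ => by positivity)
      (mem_filter.2 ⟨mem_powersetCard.2 ⟨hQ.1, hQc⟩, by simpa using hzQ⟩)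
    have s2 := single_le_sum (s := T ∩ U)
      (f := fun z => ∑ Q ∈ powersetCard q T with z ∈ Q, if Q ⊆ V then (1 : ℝ) else 0)
      (fun _ _ => sum_nonneg fun _ _ => by positivity) (mem_inter.2 ⟨hz.1.1, hz.1.2⟩)
    simp only [hQ.2, if_true] at s1
    linarith

lemma ringE_both_le (hKP : K ≤ P) (hK : 1 ≤ K) {q : ℕ} (hq : 1 ≤ q) {T U : Finset (Fin P)}
    (hT : T.card = K) (hU : U.card = K) :
    ringE K (fun V => (if q ≤ (T ∩ V).card then (1 : ℝ) else 0) *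
        if q ≤ (U ∩ V).card then 1 else 0)
      ≤ (T ∩ U).card * (q / K) * (K.choose q * inclProb K P q)
        + (K.choose q * inclProb K P q) ^ 2 := by
  refine (ringE_mono fun V _ => boole_inter_le q hq T U V).trans ?_
  rw [ringE_add]
  simp_rw [ringE_sum]
  gcongr ?_ + ?_
  · simp_rw [ringE_subset hKP]
    have : ∀ z ∈ T ∩ U, ∑ Q ∈ powersetCard q T with z ∈ Q, inclProb K P Q.card
        = (q / K) * (K.choose q * inclProb K P q) := by
      intro z hz
      have hz' : {z} ⊆ T := by simpa using (mem_inter.1 hz).1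
      have h1 := card_filter_powersetCard_subset {z} T q hz' (by simpa using hq)
      simp only [singleton_subset_iff, card_singleton, hT] at h1
      rw [sum_congr rfl fun Q hQ => by
        rw [(mem_powersetCard.1 (mem_filter.1 hQ).1).2], sum_const, h1, nsmul_eq_mul]
      have h2 : (K : ℝ) * (K - 1).choose (q - 1) = K.choose q * q := by
        obtain ⟨K', rfl⟩ := Nat.exists_eq_add_of_le' hK
        obtain ⟨q', rfl⟩ := Nat.exists_eq_add_of_le' hq
        exact_mod_cast Nat.add_one_mul_choose_eq K' q'
      have h3 : (K : ℝ) ≠ 0 := by exact_mod_cast (by omega : K ≠ 0)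
      field_simp
      linear_combination inclProb K P q * h2
    rw [sum_congr rfl this, sum_const, nsmul_eq_mul]
    ring_nf; rfl
  · calc ∑ Q ∈ powersetCard q T, ∑ R ∈ powersetCard q U,
          ringE K (fun V => if Disjoint Q R ∧ Q ∪ R ⊆ V then 1 else 0)
        ≤ ∑ Q ∈ powersetCard q T, ∑ R ∈ powersetCard q U, inclProb K P q * inclProb K P q := by
          refine sum_le_sum fun Q hQ => sum_le_sum fun R hR => ?_
          by_cases hd : Disjoint Q R
          · simp only [hd, true_and]
            rw [ringE_subset hKP, card_union_of_disjoint hd, (mem_powersetCard.1 hQ).2,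
              (mem_powersetCard.1 hR).2]
            exact inclProb_add_le hKP q q
          · simp only [hd, false_and, if_false, ringE_const hKP]
            exact mul_nonneg (inclProb_nonneg _) (inclProb_nonneg _)
      _ = _ := by
          simp only [sum_const, card_powersetCard, hT, hU, nsmul_eq_mul]; ring

end Rings

/-- Expectation in `𝔾_q(n,K,P,p)`. -/
noncomputable def graphE (n K P : ℕ) (p : ℝ) (f : Config n P → ℝ) : ℝ :=
  ∑ ω, weight n K P p ω * f ω

section Product

lemma sum_channels {E ι : Type*} [Fintype E] [DecidableEq E] [Fintype ι] (f : ι → E)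
    (hf : Function.Injective f) (p : ℝ) (g : ι → Bool → ℝ) :
    ∑ c : E → Bool, (∏ e, if c e then p else 1 - p) * ∏ i, g i (c (f i))
      = ∏ i, (p * g i true + (1 - p) * g i false) := by
  classical
  set H : E → ℝ := fun e => ∑ x : Bool, (if x then p else 1 - p) * ∏ i with f i = e, g i x with hH
  have e1 : ∀ c : E → Bool, (∏ e, if c e then p else 1 - p) * ∏ i, g i (c (f i))
      = ∏ e, ((if c e then p else 1 - p) * ∏ i with f i = e, g i (c e)) := by
    intro c
    rw [prod_mul_distrib, ← prod_fiberwise univ f]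
    congr 1
    refine prod_congr rfl fun e _ => prod_congr rfl fun i hi => ?_
    rw [(mem_filter.1 hi).2]
  simp_rw [e1]
  have e2 := prod_univ_sum (fun _ : E => (univ : Finset Bool))
    (fun e x => (if x then p else 1 - p) * ∏ i with f i = e, g i x)
  rw [Fintype.piFinset_univ] at e2
  rw [← e2]
  change ∏ e, H e = _
  have e3 : ∏ e ∈ univ.image f, H e = ∏ e, H e := by
    refine prod_subset (subset_univ _) fun e _ he => ?_
    have : univ.filter (fun i => f i = e) = ∅ := by
      refine filter_eq_empty_iff.2 fun i _ h => he ?_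
      rw [← h]; exact mem_image_of_mem f (mem_univ i)
    simp [hH, this]
  rw [← e3, prod_image fun _ _ _ _ h => hf h]
  refine prod_congr rfl fun i _ => ?_
  have : univ.filter (fun j => f j = f i) = {i} := by
    ext j; simp [hf.eq_iff]
  simp [hH, this]

lemma graphE_prod {n K P : ℕ} (p : ℝ) {R J : Type*} [Fintype R] [Fintype J]
    [DecidableEq R] [DecidableEq J] (e : R ⊕ J ≃ Fin n)
    (G : R → J → Finset (Fin P) → Finset (Fin P) → Bool → ℝ) :
    graphE n K P p (fun ω => ∏ j, ∏ a,
        G a j (ω.1 (e (.inl a))) (ω.1 (e (.inr j))) (ω.2 s(e (.inl a), e (.inr j))))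
      = ∑ τ : R → Finset (Fin P), (∏ a, ringW K (τ a)) *
          ∏ j, ringE K fun V => ∏ a, (p * G a j (τ a) V true + (1 - p) * G a j (τ a) V false) := by
  classical
  have hinj : Function.Injective fun x : J × R => s(e (.inl x.2), e (.inr x.1)) := by
    rintro ⟨j, a⟩ ⟨j', a'⟩ h
    simpa [Sym2.eq_iff, and_comm] using h
  unfold graphE weight
  rw [Fintype.sum_prod_type]
  have e1 : ∀ S : Fin n → Finset (Fin P),
      ∑ c : Sym2 (Fin n) → Bool,
        ((∏ i, if #(S i) = K then ((P.choose K : ℝ))⁻¹ else 0) *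
          ∏ x, if c x then p else 1 - p) *
          ∏ j, ∏ a, G a j (S (e (.inl a))) (S (e (.inr j))) (c s(e (.inl a), e (.inr j)))
      = (∏ i, ringW K (S i)) * ∏ j, ∏ a,
        (p * G a j (S (e (.inl a))) (S (e (.inr j))) true
          + (1 - p) * G a j (S (e (.inl a))) (S (e (.inr j))) false) := by
    intro S
    have := sum_channels _ hinj p
      (fun x => G x.2 x.1 (S (e (.inl x.2))) (S (e (.inr x.1))))
    simp only [Fintype.prod_prod_type] at this
    rw [← this, mul_sum]
    exact sum_congr rfl fun c _ => by rw [mul_assoc]; rfl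
  simp only [e1]
  rw [← Equiv.sum_comp ((Equiv.sumArrowEquivProdArrow R J (Finset (Fin P))).symm.trans
    (e.arrowCongr (Equiv.refl _))), Fintype.sum_prod_type]
  refine sum_congr rfl fun τ _ => ?_
  have e2 := prod_univ_sum (fun _ : J => (univ : Finset (Finset (Fin P))))
    (fun j V => ringW K V * ∏ a, (p * G a j (τ a) V true + (1 - p) * G a j (τ a) V false))
  rw [Fintype.piFinset_univ] at e2
  unfold ringE
  rw [e2, mul_sum]
  refine sum_congr rfl fun σ _ => ?_
  rw [← Equiv.prod_comp e, Fintype.prod_sum_type, prod_mul_distrib]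
  simp [Equiv.sumArrowEquivProdArrow, Equiv.arrowCongr, mul_assoc]

end Product

section Neighbours

variable {n K P q : ℕ} {p : ℝ}

lemma weight_nonneg (hp : p ∈ Set.Ioc (0 : ℝ) 1) (ω : Config n P) : 0 ≤ weight n K P p ω := by
  have h1 := hp.1.le
  have h2 : 0 ≤ 1 - p := by linarith [hp.2]
  unfold weight
  refine mul_nonneg (prod_nonneg fun i _ => ?_) (prod_nonneg fun e _ => ?_) <;>
    split_ifs <;> positivity

lemma graphE_mono (hp : p ∈ Set.Ioc (0 : ℝ) 1) {f g : Config n P → ℝ} (h : ∀ ω, f ω ≤ g ω) :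
    graphE n K P p f ≤ graphE n K P p g :=
  sum_le_sum fun ω _ => mul_le_mul_of_nonneg_left (h ω) (weight_nonneg hp ω)

lemma graphE_sum {ι : Type*} (s : Finset ι) (f : ι → Config n P → ℝ) :
    graphE n K P p (fun ω => ∑ i ∈ s, f i ω) = ∑ i ∈ s, graphE n K P p (f i) := by
  unfold graphE
  simp_rw [mul_sum]
  exact sum_comm

lemma graphE_add (f g : Config n P → ℝ) :
    graphE n K P p (fun ω => f ω + g ω) = graphE n K P p f + graphE n K P p g := by
  unfold graphE
  simp_rw [mul_add, sum_add_distrib]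

lemma graphE_mul_left (c : ℝ) (f : Config n P → ℝ) :
    graphE n K P p (fun ω => c * f ω) = c * graphE n K P p f := by
  unfold graphE
  simp_rw [mul_sum, mul_left_comm]

open Classical in
/-- The neighbours, outside the range of `e ∘ inl`, of the vertex `e (inl a)`. -/
noncomputable def outNbrs {R J : Type*} [Fintype J] (q : ℕ) (e : R ⊕ J ≃ Fin n) (ω : Config n P)
    (a : R) : Finset J :=
  univ.filter fun j => Adj q n P ω (e (.inl a)) (e (.inr j))

/-- Probability that a channel-and-key link exists between vertices with key rings `T`, `V`. -/
noncomputable def linkProb (q : ℕ) (p : ℝ) (T V : Finset (Fin P)) : ℝ :=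
  p * if q ≤ (T ∩ V).card then 1 else 0

lemma graphE_outNbrs {R J : Type*} [Fintype R] [Fintype J] [DecidableEq R] [DecidableEq J] (e : R ⊕ J ≃ Fin n)
    (A : R → Finset J) :
    graphE n K P p (fun ω => if ∀ a, outNbrs q e ω a = A a then 1 else 0)
      = ∑ τ : R → Finset (Fin P), (∏ a, ringW K (τ a)) *
          ∏ j, ringE K fun V => ∏ a,
            if j ∈ A a then linkProb q p (τ a) V else 1 - linkProb q p (τ a) V := by
  have key := graphE_prod (K := K) (P := P) p e (fun a j T V x =>
    if (q ≤ (T ∩ V).card ∧ x = true) ↔ j ∈ A a then (1 : ℝ) else 0)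
  have e1 : (fun ω : Config n P => if ∀ a, outNbrs q e ω a = A a then (1 : ℝ) else 0)
      = fun ω => ∏ j, ∏ a, if (q ≤ ((ω.1 (e (.inl a))) ∩ (ω.1 (e (.inr j)))).card ∧
          ω.2 s(e (.inl a), e (.inr j)) = true) ↔ j ∈ A a then (1 : ℝ) else 0 := by
    funext ω
    simp only [prod_boole, mem_univ, true_implies]
    refine if_congr ?_ rfl rfl
    simp only [outNbrs, Finset.ext_iff, mem_filter, mem_univ, true_and, Adj, ne_eq,
      EmbeddingLike.apply_eq_iff_eq, reduceCtorEq, not_false_eq_true]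
    exact forall_comm
  rw [e1, key]
  refine sum_congr rfl fun τ _ => ?_
  congr 1
  refine prod_congr rfl fun j _ => ?_
  congr 1
  funext V
  refine prod_congr rfl fun a _ => ?_
  unfold linkProb
  by_cases h1 : j ∈ A a <;> by_cases h2 : q ≤ (τ a ∩ V).card <;> simp [h1, h2]

lemma ringE_linkProb (hKP : K ≤ P) {T : Finset (Fin P)} (hT : T.card = K) :
    ringE K (linkProb q p T) = peq q K P p := by
  unfold linkProb peq
  rw [psq_eq hKP q hT, ← ringE_mul_left]

lemma sum_ringW (hKP : K ≤ P) : ∑ T : Finset (Fin P), ringW K T = 1 := by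
  simpa [ringE] using ringE_const hKP (1 : ℝ)

lemma exists_equiv_extending {R : Type} [Fintype R] (o : R → Fin n) (ho : Function.Injective o) :
    ∃ (J : Type) (_ : Fintype J) (e : R ⊕ J ≃ Fin n), ∀ a, e (.inl a) = o a := by
  classical
  refine ⟨↥(Set.range o)ᶜ, inferInstance,
    ((Equiv.ofInjective o ho).sumCongr (Equiv.refl _)).trans (Equiv.Set.sumCompl (Set.range o)), ?_⟩
  intro a
  simp

lemma card_outNbrs_le {R J : Type*} [Fintype J] (e : R ⊕ J ≃ Fin n) (ω : Config n P) (a : R) :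
    (outNbrs q e ω a).card ≤ degree q n P ω (e (.inl a)) := by
  classical
  unfold degree outNbrs
  rw [← Fintype.card_subtype, ← Nat.card_eq_fintype_card]
  refine Nat.card_le_card_of_injective (fun j => ⟨e (.inr j.1), j.2⟩) ?_
  intro j j' h
  simpa [Subtype.ext_iff] using h

lemma card_outNbrs_unit {J : Type*} [Fintype J] (e : Unit ⊕ J ≃ Fin n) (ω : Config n P) :
    (outNbrs q e ω ()).card = degree q n P ω (e (.inl ())) := by
  classical
  unfold degree outNbrs
  rw [← Fintype.card_subtype, ← Nat.card_eq_fintype_card]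
  refine Nat.card_eq_of_bijective (fun j => ⟨e (.inr j.1), j.2⟩) ⟨?_, ?_⟩
  · intro j j' h
    simpa [Subtype.ext_iff] using h
  · rintro ⟨v, hv⟩
    obtain ⟨x | j, rfl⟩ := e.surjective v
    · exact absurd rfl hv.1
    · exact ⟨⟨j, hv⟩, rfl⟩

lemma graphE_degree (hKP : K ≤ P) (i : Fin n) (d : ℕ) :
    graphE n K P p (fun ω => if degree q n P ω i = d then 1 else 0)
      = (n - 1).choose d * peq q K P p ^ d * (1 - peq q K P p) ^ (n - 1 - d) := by
  classical
  obtain ⟨J, _, e, he⟩ := exists_equiv_extending (fun _ : Unit => i)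
    (Function.injective_of_subsingleton _)
  have hJ : Fintype.card J = n - 1 := by
    have := Fintype.card_congr e
    simp at this
    omega
  have e1 : (fun ω : Config n P => if degree q n P ω i = d then (1 : ℝ) else 0)
      = fun ω => ∑ A ∈ powersetCard d (univ : Finset J),
          if ∀ a, outNbrs q e ω a = A then 1 else 0 := by
    funext ω
    rw [← he (), ← card_outNbrs_unit]
    have h : ∀ A, (∀ a, outNbrs q e ω a = A) ↔ outNbrs q e ω () = A :=
      fun A => ⟨fun h => h (), fun h _ => h⟩
    simp only [h, sum_ite_eq, mem_powersetCard_univ]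
  rw [e1, graphE_sum]
  have e2 : ∀ A ∈ powersetCard d (univ : Finset J),
      graphE n K P p (fun ω => if ∀ a, outNbrs q e ω a = A then 1 else 0)
        = peq q K P p ^ d * (1 - peq q K P p) ^ (n - 1 - d) := by
    intro A hA
    rw [graphE_outNbrs e fun _ => A, ← (Equiv.funUnique Unit (Finset (Fin P))).symm.sum_comp]
    simp only [univ_unique, prod_singleton]
    have e3 : ∀ T : Finset (Fin P), ringW K T * ∏ j, ringE K (fun V =>
        if j ∈ A then linkProb q p T V else 1 - linkProb q p T V)
        = ringW K T * (peq q K P p ^ d * (1 - peq q K P p) ^ (n - 1 - d)) := by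
      intro T
      by_cases hT : T.card = K
      · congr 1
        have e4 : ∀ j, ringE K (fun V =>
            if j ∈ A then linkProb q p T V else 1 - linkProb q p T V)
            = if j ∈ A then peq q K P p else 1 - peq q K P p := by
          intro j
          split_ifs
          · exact ringE_linkProb hKP hT
          · rw [ringE_sub, ringE_const hKP, ringE_linkProb hKP hT]
        simp_rw [e4]
        rw [prod_ite, prod_const, prod_const, filter_mem_eq_inter, univ_inter, filter_not,
          filter_mem_eq_inter, univ_inter, ← compl_eq_univ_sdiff, card_compl, hJ,
          (mem_powersetCard.1 hA).2]
      · simp [ringW, hT]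
    have e5 := sum_congr rfl fun T (_ : T ∈ univ) => e3 T
    refine Eq.trans e5 ?_
    rw [← sum_mul, sum_ringW hKP, one_mul]
  rw [sum_congr rfl e2, sum_const, card_powersetCard, card_univ, hJ, nsmul_eq_mul, mul_assoc]

lemma sum_pow_card_union_le {J : Type*} [Fintype J] [DecidableEq J] {x : ℝ} (hx : 0 ≤ x) (m : ℕ) :
    ∑ A : Finset J, ∑ B : Finset J, (if A.card ≤ m ∧ B.card ≤ m then x ^ (A ∪ B).card else 0)
      ≤ ((Fintype.card J).choose m : ℝ) ^ 2 * x ^ (2 * m)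
        + ∑ l ∈ range (2 * m), (4 * Fintype.card J * x) ^ l := by
  have h1 : ∀ A B : Finset J, (if A.card ≤ m ∧ B.card ≤ m then x ^ (A ∪ B).card else 0)
      ≤ (if A.card = m then 1 else 0) * (if B.card = m then 1 else 0) * x ^ (2 * m)
        + ∑ C with C.card < 2 * m, (if A ⊆ C then 1 else 0) * (if B ⊆ C then 1 else 0) * x ^ C.card := by
    intro A B
    have n1 : 0 ≤ (if A.card = m then (1 : ℝ) else 0) * (if B.card = m then 1 else 0) * x ^ (2 * m) := by
      positivity
    have n2 : ∀ C : Finset J, 0 ≤ (if A ⊆ C then (1 : ℝ) else 0) * (if B ⊆ C then 1 else 0)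
        * x ^ C.card := fun C => by positivity
    have n3 := sum_nonneg fun C (_ : C ∈ univ.filter fun C : Finset J => C.card < 2 * m) => n2 C
    by_cases h : A.card ≤ m ∧ B.card ≤ m
    · rw [if_pos h]
      rcases lt_or_ge (A ∪ B).card (2 * m) with h' | h'
      · have := single_le_sum (s := univ.filter fun C : Finset J => C.card < 2 * m)
          (fun C _ => n2 C) (mem_filter.2 ⟨mem_univ _, h'⟩)
        simp only [subset_union_left, subset_union_right, if_true, one_mul] at this
        linarith
      · have h'' := card_union_le A B
        have hA : A.card = m := by omega
        have hB : B.card = m := by omega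
        have hAB : (A ∪ B).card = 2 * m := by omega
        rw [hAB]
        simp only [hA, hB, if_true, one_mul]
        linarith
    · rw [if_neg h]
      linarith
  refine (sum_le_sum fun A _ => sum_le_sum fun B _ => h1 A B).trans ?_
  simp only [sum_add_distrib]
  gcongr ?_ + ?_
  · apply le_of_eq
    have : ∑ A : Finset J, (if A.card = m then (1 : ℝ) else 0) = (Fintype.card J).choose m := by
      rw [sum_boole, ← card_univ, ← card_powersetCard]
      congr 2
      ext; simp
    simp_rw [← sum_mul, ← mul_sum, this, ← sum_mul, this]
    ring
  · have e1 : ∀ C : Finset J, ∑ A : Finset J, (if A ⊆ C then (1 : ℝ) else 0) = 2 ^ C.card := by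
      intro C
      rw [sum_boole]
      have : univ.filter (fun A => A ⊆ C) = C.powerset := by ext; simp
      rw [this, card_powerset]; simp
    calc _ = ∑ C : Finset J with C.card < 2 * m, (4 * x) ^ C.card := by
          rw [sum_congr rfl fun A _ => sum_comm, sum_comm]
          refine sum_congr rfl fun C _ => ?_
          simp_rw [← sum_mul, ← mul_sum, e1, ← sum_mul, e1]
          rw [← mul_pow, ← mul_pow]; norm_num
      _ = ∑ l ∈ range (2 * m), ∑ C : Finset J with C.card = l, (4 * x) ^ l := by
          rw [← sum_fiberwise_of_maps_to (t := range (2 * m)) (g := fun C : Finset J => C.card)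
            (fun C hC => by simpa using hC)]
          refine sum_congr rfl fun l hl => ?_
          refine sum_congr ?_ ?_
          · ext C
            have := mem_range.1 hl
            simp only [mem_filter, mem_univ, true_and]
            omega
          · intro C hC
            rw [(mem_filter.1 hC).2]
      _ ≤ _ := by
          refine sum_le_sum fun l _ => ?_
          rw [sum_const, nsmul_eq_mul]
          have : #{C : Finset J | C.card = l} = (Fintype.card J).choose l := by
            rw [← card_univ, ← card_powersetCard]; congr 1; ext; simp [mem_powersetCard]
          rw [this, mul_right_comm, mul_comm, mul_pow _ (Fintype.card J : ℝ)]
          gcongr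
          exact_mod_cast Nat.choose_le_pow _ _

end Neighbours

section Pairs

variable {n K P q : ℕ} {p : ℝ}

lemma exists_ring (hKP : K ≤ P) : ∃ T : Finset (Fin P), T.card = K := by
  obtain ⟨T, -, hT⟩ := exists_subset_card_eq (s := (univ : Finset (Fin P))) (n := K)
    (by simpa using hKP)
  exact ⟨T, hT⟩

lemma psq_nonneg (hKP : K ≤ P) : 0 ≤ psq q K P := by
  obtain ⟨T, hT⟩ := exists_ring hKP
  rw [psq_eq hKP q hT]
  exact ringE_nonneg fun V => by positivity

lemma peq_nonneg (hKP : K ≤ P) (hp : p ∈ Set.Ioc (0 : ℝ) 1) : 0 ≤ peq q K P p :=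
  mul_nonneg hp.1.le (psq_nonneg hKP)

lemma linkProb_nonneg (hp : p ∈ Set.Ioc (0 : ℝ) 1) (T V : Finset (Fin P)) :
    0 ≤ linkProb q p T V := by
  have := hp.1
  unfold linkProb; positivity

lemma linkProb_le_one (hp : p ∈ Set.Ioc (0 : ℝ) 1) (T V : Finset (Fin P)) :
    linkProb q p T V ≤ 1 := by
  have := hp.2
  unfold linkProb; split_ifs <;> linarith

/-- Probability of linking to two vertices with key rings `T` and `U`. -/
noncomputable def bothProb {P : ℕ} (K q : ℕ) (p : ℝ) (T U : Finset (Fin P)) : ℝ :=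
  ringE K fun V => linkProb q p T V * linkProb q p U V

lemma bothProb_nonneg (hp : p ∈ Set.Ioc (0 : ℝ) 1) (T U : Finset (Fin P)) :
    0 ≤ bothProb K q p T U :=
  ringE_nonneg fun V => mul_nonneg (linkProb_nonneg hp T V) (linkProb_nonneg hp U V)

lemma bothProb_le_peq (hp : p ∈ Set.Ioc (0 : ℝ) 1) (hKP : K ≤ P) {T : Finset (Fin P)}
    (hT : T.card = K) (U : Finset (Fin P)) : bothProb K q p T U ≤ peq q K P p := by
  rw [← ringE_linkProb hKP hT]
  exact ringE_mono fun V _ => mul_le_of_le_one_right (linkProb_nonneg hp T V)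
    (linkProb_le_one hp U V)

lemma bothProb_le (hp : p ∈ Set.Ioc (0 : ℝ) 1) (hKP : K ≤ P) (hK : 1 ≤ K) (hq : 1 ≤ q)
    (hx : (K : ℝ) ^ 2 / P ≤ 1 / 2) {T U : Finset (Fin P)} (hT : T.card = K) (hU : U.card = K) :
    bothProb K q p T U ≤ 4 * peq q K P p ^ 2 + 2 * q * p * peq q K P p / K * (T ∩ U).card := by
  have h1 := ringE_both_le hKP hK hq hT hU
  have h2 := le_psq hKP q
  set M := K.choose q * inclProb K P q with hM
  have hM0 : 0 ≤ M := mul_nonneg (by positivity) (inclProb_nonneg _)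
  have hMs : M ≤ 2 * psq q K P := by nlinarith
  have e : bothProb K q p T U = p ^ 2 * ringE K (fun V => (if q ≤ (T ∩ V).card then (1 : ℝ) else 0)
      * if q ≤ (U ∩ V).card then 1 else 0) := by
    rw [← ringE_mul_left]
    unfold bothProb linkProb
    congr 1; funext V; ring
  rw [e]
  have hp0 := hp.1
  calc _ ≤ p ^ 2 * ((T ∩ U).card * (q / K) * M + M ^ 2) := by gcongr
    _ ≤ p ^ 2 * ((T ∩ U).card * (q / K) * (2 * psq q K P) + (2 * psq q K P) ^ 2) := by gcongr
    _ = _ := by unfold peq; ring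

lemma ringE_nonlink_both (hKP : K ≤ P) {T U : Finset (Fin P)} (hT : T.card = K)
    (hU : U.card = K) :
    ringE K (fun V => (1 - linkProb q p T V) * (1 - linkProb q p U V))
      = 1 - 2 * peq q K P p + bothProb K q p T U := by
  have : (fun V => (1 - linkProb q p T V) * (1 - linkProb q p U V))
      = fun V => (1 - linkProb q p T V) - linkProb q p U V
        + linkProb q p T V * linkProb q p U V := by
    funext V; ring
  rw [this, ringE_add, ringE_sub, ringE_sub, ringE_const hKP, ringE_linkProb hKP hT,
    ringE_linkProb hKP hU]
  unfold bothProb; ring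

lemma one_sub_two_mul_add_pow_le {x r : ℝ} (hx : x ≤ 1 / 2) (hr : 0 ≤ r)
    (hw : 0 ≤ 1 - 2 * x + r) (N : ℕ) :
    (1 - 2 * x + r) ^ N ≤ (1 - x) ^ (2 * N) * Real.exp (4 * N * r) := by
  have h1 : 1 - 2 * x + r ≤ (1 - x) ^ 2 * Real.exp (4 * r) := by
    have h2 := Real.add_one_le_exp (4 * r)
    have h3 : 1 / 4 ≤ (1 - x) ^ 2 := by nlinarith
    nlinarith [sq_nonneg x]
  calc _ ≤ ((1 - x) ^ 2 * Real.exp (4 * r)) ^ N := by gcongr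
    _ = _ := by rw [mul_pow, ← pow_mul, ← Real.exp_nat_mul]; congr 2; ring

lemma ringE_pair_pow_le (hp : p ∈ Set.Ioc (0 : ℝ) 1) (hKP : K ≤ P) (hK : 1 ≤ K) (hq : 1 ≤ q)
    (hx : (K : ℝ) ^ 2 / P ≤ 1 / 2) (hpe : peq q K P p ≤ 1 / 2) {N : ℕ} (hN : N ≤ n) :
    ringE K (fun T : Finset (Fin P) => ringE K fun U =>
        (1 - 2 * peq q K P p + bothProb K q p T U) ^ N)
      ≤ Real.exp (16 * n * peq q K P p ^ 2
          + (Real.exp (8 * q * p * (n * peq q K P p) / K) - 1) * ((K : ℝ) ^ 2 / P))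
        * (1 - peq q K P p) ^ (2 * N) := by
  have hpe0 := peq_nonneg (q := q) hKP hp
  have hp0 := hp.1
  set x := peq q K P p with hxdef
  set l := 8 * q * p * (n * x) / K with hl
  have hl0 : 0 ≤ l := by positivity
  have hN' : (N : ℝ) ≤ n := by exact_mod_cast hN
  rw [← ringE_const hKP (P := P) (K := K) (Real.exp _ * _)]
  refine ringE_mono fun T hT => ?_
  calc ringE K (fun U => (1 - 2 * x + bothProb K q p T U) ^ N)
      ≤ ringE K (fun U => ((1 - x) ^ (2 * N) * Real.exp (16 * n * x ^ 2))
          * Real.exp (l * (T ∩ U).card)) := by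
        refine ringE_mono fun U hU => ?_
        have hb0 := bothProb_nonneg (K := K) (q := q) hp T U
        have hb := bothProb_le hp hKP hK hq hx hT hU
        refine (one_sub_two_mul_add_pow_le hpe hb0 (by linarith) N).trans ?_
        rw [mul_assoc ((1 - x) ^ (2 * N)), ← Real.exp_add]
        have h1 : 0 ≤ (1 - x) ^ (2 * N) := by rw [pow_mul]; positivity
        gcongr
        calc 4 * N * bothProb K q p T U
            ≤ 4 * n * (4 * x ^ 2 + 2 * q * p * x / K * (T ∩ U).card) := by gcongr
          _ = _ := by rw [hl]; ring
    _ = ((1 - x) ^ (2 * N) * Real.exp (16 * n * x ^ 2))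
          * ringE K (fun U => Real.exp (l * (T ∩ U).card)) := by rw [ringE_mul_left]
    _ ≤ ((1 - x) ^ (2 * N) * Real.exp (16 * n * x ^ 2))
          * Real.exp ((Real.exp l - 1) * ((K : ℝ) ^ 2 / P)) := by
        have h1 : 0 ≤ (1 - x) ^ (2 * N) := by rw [pow_mul]; positivity
        gcongr
        exact ringE_exp_inter hKP hT hl0
    _ = _ := by rw [Real.exp_add]; ring

lemma graphE_outNbrs_pair_le (hp : p ∈ Set.Ioc (0 : ℝ) 1) (hKP : K ≤ P) {J : Type*} [Fintype J]
    [DecidableEq J] (e : Bool ⊕ J ≃ Fin n) (A B : Finset J) {N : ℕ}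
    (hN : N + (A ∪ B).card ≤ Fintype.card J) :
    graphE n K P p (fun ω => if outNbrs q e ω false = A ∧ outNbrs q e ω true = B then 1 else 0)
      ≤ peq q K P p ^ (A ∪ B).card * ringE K (fun T : Finset (Fin P) => ringE K fun U =>
        (1 - 2 * peq q K P p + bothProb K q p T U) ^ N) := by
  have hpe0 := peq_nonneg (q := q) hKP hp
  set x := peq q K P p with hxdef
  have e2 : ∀ F : (Bool → Finset (Fin P)) → ℝ,
      ∑ τ, F τ = ∑ T, ∑ U, F fun b => if b then U else T := by
    intro F
    rw [← Fintype.sum_prod_type', ← (Equiv.boolArrowEquivProd (Finset (Fin P))).symm.sum_comp]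
    rfl
  have hE := graphE_outNbrs (K := K) (P := P) (p := p) (q := q) e fun a => if a then B else A
  rw [e2] at hE
  refine (Eq.trans ?_ hE).trans_le ?_
  · congr 1
    funext ω
    split_ifs <;> simp_all
  simp only [Fintype.prod_bool, if_true, Bool.false_eq_true, if_false]
  rw [← ringE_mul_left]
  simp_rw [← ringE_mul_left]
  unfold ringE
  simp_rw [mul_sum]
  refine sum_le_sum fun T _ => sum_le_sum fun U _ => ?_
  by_cases hT : T.card = K
  swap
  · simp [ringW, hT]
  by_cases hU : U.card = K
  swap
  · simp [ringW, hU]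
  rw [mul_comm (ringW K U), mul_assoc]
  refine mul_le_mul_of_nonneg_left (mul_le_mul_of_nonneg_left ?_ (ringW_nonneg U)) (ringW_nonneg T)
  set w := 1 - 2 * x + bothProb K q p T U with hw
  have hwE := ringE_nonlink_both (q := q) (p := p) hKP hT hU
  rw [← hxdef, ← hw] at hwE
  have hl1 := fun V => sub_nonneg.2 (linkProb_le_one (q := q) hp T V)
  have hl2 := fun V => sub_nonneg.2 (linkProb_le_one (q := q) hp U V)
  have hw0 : 0 ≤ w := by
    rw [← hwE]
    exact ringE_nonneg fun V => mul_nonneg (hl1 V) (hl2 V)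
  have hw1 : w ≤ 1 := by
    have := bothProb_le_peq (q := q) hp hKP hT U
    linarith
  have hj : ∀ j, ringE K (fun V =>
      (if j ∈ B then linkProb q p U V else 1 - linkProb q p U V) *
        if j ∈ A then linkProb q p T V else 1 - linkProb q p T V)
      ≤ if j ∈ A ∪ B then x else w := by
    intro j
    by_cases hA : j ∈ A
    · simp only [hA, mem_union, true_or, if_true]
      rw [hxdef, ← ringE_linkProb hKP hT]
      refine ringE_mono fun V _ => mul_le_of_le_one_left (linkProb_nonneg hp T V) ?_
      have := linkProb_le_one (q := q) hp U V
      have := linkProb_nonneg (q := q) hp U V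
      split_ifs <;> linarith
    · by_cases hB : j ∈ B
      · simp only [hA, hB, mem_union, or_true, if_true, if_false]
        rw [hxdef, ← ringE_linkProb hKP hU]
        refine ringE_mono fun V _ => mul_le_of_le_one_right (linkProb_nonneg hp U V) ?_
        have := linkProb_nonneg (q := q) hp T V
        linarith
      · simp only [hA, hB, mem_union, or_self, if_false]
        rw [← hwE]
        exact ringE_mono fun V _ => (mul_comm _ _).le
  refine (prod_le_prod (fun j _ => ?_) fun j _ => hj j).trans ?_
  · refine ringE_nonneg fun V => mul_nonneg ?_ ?_ <;> split_ifs <;>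
      first | exact hl1 V | exact hl2 V | exact linkProb_nonneg hp _ V
  rw [prod_ite, prod_const, prod_const, filter_mem_eq_inter, univ_inter, filter_not,
    filter_mem_eq_inter, univ_inter, ← compl_eq_univ_sdiff, card_compl]
  exact mul_le_mul_of_nonneg_left (pow_le_pow_of_le_one hw0 hw1 (by omega)) (by positivity)

lemma graphE_degree_pair_le (hp : p ∈ Set.Ioc (0 : ℝ) 1) (hKP : K ≤ P) (hK : 1 ≤ K)
    (hq : 1 ≤ q) (hx : (K : ℝ) ^ 2 / P ≤ 1 / 2) (hpe : peq q K P p ≤ 1 / 2) {m : ℕ}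
    (hm : 2 * m + 2 ≤ n) {i j : Fin n} (hij : i ≠ j) :
    graphE n K P p (fun ω => if degree q n P ω i = m ∧ degree q n P ω j = m then 1 else 0)
      ≤ (((n - 1).choose m : ℝ) ^ 2 * peq q K P p ^ (2 * m)
          + ∑ l ∈ range (2 * m), (4 * n * peq q K P p) ^ l)
        * (Real.exp (16 * n * peq q K P p ^ 2
          + (Real.exp (8 * q * p * (n * peq q K P p) / K) - 1) * ((K : ℝ) ^ 2 / P))
        * (1 - peq q K P p) ^ (2 * (n - 2 - 2 * m))) := by
  classical
  have hpe0 := peq_nonneg (q := q) hKP hp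
  obtain ⟨J, _, e, he⟩ := exists_equiv_extending (fun b : Bool => if b then j else i) (by
    intro a b h
    cases a <;> cases b <;> simp_all)
  have hi : e (.inl false) = i := by simpa using he false
  have hj : e (.inl true) = j := by simpa using he true
  have hJ : Fintype.card J = n - 2 := by
    have := Fintype.card_congr e
    simp at this
    omega
  set x := peq q K P p with hxdef
  set W := ringE K (fun T : Finset (Fin P) => ringE K fun U =>
        (1 - 2 * x + bothProb K q p T U) ^ (n - 2 - 2 * m)) with hW
  have hWle := ringE_pair_pow_le (n := n) hp hKP hK hq hx hpe (N := n - 2 - 2 * m) (by omega)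
  have hR0 : 0 ≤ (1 - x) ^ (2 * (n - 2 - 2 * m)) := by rw [pow_mul]; positivity
  have e1 : ∀ ω : Config n P,
      (if degree q n P ω i = m ∧ degree q n P ω j = m then (1 : ℝ) else 0)
      ≤ ∑ A : Finset J, ∑ B : Finset J, (if A.card ≤ m ∧ B.card ≤ m then 1 else 0) *
          if outNbrs q e ω false = A ∧ outNbrs q e ω true = B then 1 else 0 := by
    intro ω
    have n1 : ∀ A B : Finset J, (0 : ℝ) ≤ (if A.card ≤ m ∧ B.card ≤ m then 1 else 0) *
          if outNbrs q e ω false = A ∧ outNbrs q e ω true = B then 1 else 0 :=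
      fun A B => by positivity
    by_cases h : degree q n P ω i = m ∧ degree q n P ω j = m
    · rw [if_pos h]
      have s1 := single_le_sum (fun B _ => n1 (outNbrs q e ω false) B)
        (mem_univ (outNbrs q e ω true))
      have s2 := single_le_sum (fun A _ => sum_nonneg fun B (_ : B ∈ univ) => n1 A B)
        (mem_univ (outNbrs q e ω false))
      have c1 := card_outNbrs_le (q := q) e ω false
      have c2 := card_outNbrs_le (q := q) e ω true
      rw [hi, h.1] at c1
      rw [hj, h.2] at c2
      exact (by simp [c1, c2] : (1 : ℝ) ≤ _).trans (s1.trans s2)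
    · rw [if_neg h]
      exact sum_nonneg fun A _ => sum_nonneg fun B _ => n1 A B
  have hsum := sum_pow_card_union_le (J := J) hpe0 m
  rw [hJ] at hsum
  calc _ ≤ ∑ A : Finset J, ∑ B : Finset J, (if A.card ≤ m ∧ B.card ≤ m then 1 else 0) *
        graphE n K P p (fun ω =>
          if outNbrs q e ω false = A ∧ outNbrs q e ω true = B then 1 else 0) := by
        refine (graphE_mono hp e1).trans_eq ?_
        simp_rw [graphE_sum, graphE_mul_left]
    _ ≤ ∑ A : Finset J, ∑ B : Finset J,
        (if A.card ≤ m ∧ B.card ≤ m then x ^ (A ∪ B).card else 0) * W := by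
        refine sum_le_sum fun A _ => sum_le_sum fun B _ => ?_
        by_cases h : A.card ≤ m ∧ B.card ≤ m
        · rw [if_pos h, if_pos h, one_mul]
          refine graphE_outNbrs_pair_le hp hKP e A B ?_
          have := card_union_le A B
          omega
        · simp [h]
    _ = (∑ A : Finset J, ∑ B : Finset J,
        (if A.card ≤ m ∧ B.card ≤ m then x ^ (A ∪ B).card else 0)) * W := by
        simp_rw [sum_mul]
    _ ≤ _ := by
        refine mul_le_mul (hsum.trans ?_) hWle ?_ ?_
        · gcongr <;> omega
        · rw [← ringE_const hKP (P := P) (K := K) 0, hW]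
          refine ringE_mono fun T hT => ?_
          rw [← ringE_const hKP (P := P) (K := K) 0]
          refine ringE_mono fun U hU => pow_nonneg ?_ _
          rw [hxdef, ← ringE_nonlink_both hKP hT hU]
          exact ringE_nonneg fun V => mul_nonneg (sub_nonneg.2 (linkProb_le_one hp T V))
            (sub_nonneg.2 (linkProb_le_one hp U V))
        · positivity

end Pairs

section MinDegree

variable {n K P q : ℕ} {p : ℝ}

lemma graphE_const (hKP : K ≤ P) (c : ℝ) : graphE n K P p (fun _ => c) = c := by
  have h1 : ∑ S : Fin n → Finset (Fin P), ∏ i, ringW K (S i) = 1 := by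
    rw [← Fintype.prod_sum, prod_const, sum_ringW hKP, one_pow]
  have h2 : ∑ s : Sym2 (Fin n) → Bool, ∏ e, (if s e then p else 1 - p) = 1 := by
    rw [← Fintype.prod_sum (fun (_ : Sym2 (Fin n)) (t : Bool) => if t then p else 1 - p)]
    simp
  have h3 : ∑ ω : Config n P, weight n K P p ω = 1 := by
    rw [← mul_one (1 : ℝ)]
    nth_rewrite 1 [← h1]
    rw [← h2, Fintype.sum_mul_sum, ← Fintype.sum_prod_type']
    rfl
  unfold graphE
  rw [← sum_mul, h3, one_mul]

lemma prob_eq_graphE (E : Set (Config n P)) [DecidablePred (· ∈ E)] :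
    prob n K P p E = graphE n K P p (fun ω => if ω ∈ E then 1 else 0) := by
  unfold prob graphE
  simp [Set.indicator_apply]

lemma prob_le_one (hp : p ∈ Set.Ioc (0 : ℝ) 1) (hKP : K ≤ P) (E : Set (Config n P)) :
    prob n K P p E ≤ 1 := by
  classical
  rw [prob_eq_graphE]
  refine (graphE_mono hp (g := fun _ => 1) fun ω => ?_).trans_eq (graphE_const hKP 1)
  split_ifs <;> norm_num

lemma minDeg_eq {m : ℕ} (ω : Config n P) (h : ∀ i, m ≤ degree q n P ω i) {i : Fin n}
    (hi : degree q n P ω i = m) : minDeg q n P ω = m := by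
  refine le_antisymm (hi ▸ Nat.sInf_le ⟨i, rfl⟩) (le_csInf ⟨_, i, rfl⟩ ?_)
  rintro _ ⟨j, rfl⟩
  exact h j

/-- Second moment bound for the event that the minimum degree is `m`. -/
lemma one_le_prob_minDeg_add (hp : p ∈ Set.Ioc (0 : ℝ) 1) (hKP : K ≤ P) {m : ℕ} {g : ℕ → ℝ}
    {r : ℝ} (hn : 0 < n)
    (hg : ∀ (i : Fin n) d, graphE n K P p (fun ω => if degree q n P ω i = d then 1 else 0) = g d)
    (hm : 0 < g m)
    (hr : ∀ i j : Fin n, i ≠ j → graphE n K P p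
      (fun ω => if degree q n P ω i = m ∧ degree q n P ω j = m then 1 else 0) ≤ r) (hr0 : 0 ≤ r) :
    1 ≤ prob n K P p {ω | minDeg q n P ω = m} + ∑ d ∈ range m, n * g d
      + ((n * g m)⁻¹ + r / g m ^ 2 - 1) := by
  classical
  have hn' : (0 : ℝ) < n := by exact_mod_cast hn
  set X : Config n P → ℝ := fun ω => ∑ i, if degree q n P ω i = m then 1 else 0 with hX
  set μ := n * g m with hμ
  have hμ0 : 0 < μ := by positivity
  have hEX : graphE n K P p X = μ := by
    rw [hX, graphE_sum]
    simp [hg, hμ]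
  have hEX2 : graphE n K P p (fun ω => X ω ^ 2) ≤ μ + n ^ 2 * r := by
    have e : (fun ω => X ω ^ 2) = fun ω => ∑ i, ∑ j,
        if degree q n P ω i = m ∧ degree q n P ω j = m then (1 : ℝ) else 0 := by
      funext ω
      rw [hX, sq, Fintype.sum_mul_sum]
      refine sum_congr rfl fun i _ => sum_congr rfl fun j _ => ?_
      rw [ite_and]
      split_ifs <;> simp
    rw [e, graphE_sum]
    calc _ ≤ ∑ i : Fin n, ∑ j, ((if i = j then g m else 0) + r) := by
          refine sum_le_sum fun i _ => ?_
          rw [graphE_sum]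
          refine sum_le_sum fun j _ => ?_
          by_cases h : i = j
          · subst h
            simp [hg, hr0]
          · simpa [h] using hr i j h
      _ = μ + n ^ 2 * r := by
          simp [sum_add_distrib, hμ]
          ring
  have key : ∀ ω : Config n P, (1 : ℝ) ≤ (if ω ∈ {ω | minDeg q n P ω = m} then 1 else 0)
      + ∑ d ∈ range m, ∑ i, (if degree q n P ω i = d then 1 else 0)
      + ((μ⁻¹) ^ 2 * X ω ^ 2 + ((-2 * μ⁻¹) * X ω + 1)) := by
    intro ω
    have hsq : (μ⁻¹) ^ 2 * X ω ^ 2 + ((-2 * μ⁻¹) * X ω + 1) = (μ⁻¹ * X ω - 1) ^ 2 := by ring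
    have h1 : (0 : ℝ) ≤ if ω ∈ {ω | minDeg q n P ω = m} then 1 else 0 := by positivity
    have h2 : (0 : ℝ) ≤ ∑ d ∈ range m, ∑ i, (if degree q n P ω i = d then 1 else 0) := by
      positivity
    rw [hsq]
    by_cases hlow : ∀ i, m ≤ degree q n P ω i
    · by_cases hex : ∃ i, degree q n P ω i = m
      · obtain ⟨i, hi⟩ := hex
        rw [if_pos (by exact minDeg_eq ω hlow hi)]
        nlinarith [sq_nonneg (μ⁻¹ * X ω - 1)]
      · have : X ω = 0 := sum_eq_zero fun i _ => if_neg fun h => hex ⟨i, h⟩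
        rw [this]
        nlinarith
    · push Not at hlow
      obtain ⟨i, hi⟩ := hlow
      have h3 : (1 : ℝ) ≤ ∑ d ∈ range m, ∑ i, (if degree q n P ω i = d then 1 else 0) := by
        refine le_trans ?_ (single_le_sum (f := fun d => ∑ i, (if degree q n P ω i = d
          then (1 : ℝ) else 0)) (fun d _ => by positivity) (mem_range.2 hi))
        refine le_trans ?_ (single_le_sum (f := fun j => if degree q n P ω j = degree q n P ω i
          then (1 : ℝ) else 0) (fun d _ => by positivity) (mem_univ i))
        simp
      nlinarith [sq_nonneg (μ⁻¹ * X ω - 1)]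
  have := graphE_mono (K := K) hp key
  rw [graphE_const hKP, graphE_add, graphE_add, graphE_add, graphE_add, graphE_const hKP,
    graphE_mul_left, graphE_mul_left, hEX, ← prob_eq_graphE, graphE_sum] at this
  simp_rw [graphE_sum, hg] at this
  refine this.trans ?_
  simp only [sum_const, card_univ, Fintype.card_fin, nsmul_eq_mul]
  have h4 : μ⁻¹ ^ 2 * graphE n K P p (fun ω => X ω ^ 2) ≤ μ⁻¹ + r / g m ^ 2 := by
    calc _ ≤ μ⁻¹ ^ 2 * (μ + n ^ 2 * r) := by gcongr
      _ = _ := by rw [hμ]; field_simp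
  have h5 : -2 * μ⁻¹ * μ = -2 := by field_simp
  linarith

end MinDegree

section Estimates

variable {n m d : ℕ} {s : ℝ}

lemma binomial_mass_le (hs0 : 0 ≤ s) (hs1 : s ≤ 1) (hd : d + 1 ≤ n) :
    ((n - 1).choose d : ℝ) * s ^ d * (1 - s) ^ (n - 1 - d)
      ≤ (n * s) ^ d * (Real.exp (-(n * s)) * Real.exp (1 + d)) := by
  have h1 : ((n - 1).choose d : ℝ) ≤ (n : ℝ) ^ d := by
    exact_mod_cast (Nat.choose_le_pow _ _).trans (Nat.pow_le_pow_left (by omega) _)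
  have h2 : (1 - s) ^ (n - 1 - d) ≤ Real.exp (-(n * s)) * Real.exp (1 + d) := by
    calc (1 - s) ^ (n - 1 - d) ≤ Real.exp (-s) ^ (n - 1 - d) := by
          have := Real.add_one_le_exp (-s)
          have : 0 ≤ 1 - s := by linarith
          gcongr
          linarith
      _ ≤ _ := by
          rw [← Real.exp_nat_mul, ← Real.exp_add]
          have : ((n - 1 - d : ℕ) : ℝ) = n - 1 - d := by
            rw [Nat.sub_sub, Nat.cast_sub (by omega)]; push_cast; ring
          rw [this]
          gcongr
          have : (0 : ℝ) ≤ d := by positivity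
          nlinarith
  have h3 : 0 ≤ (1 - s) ^ (n - 1 - d) := pow_nonneg (by linarith) _
  calc _ ≤ (n : ℝ) ^ d * s ^ d * (Real.exp (-(n * s)) * Real.exp (1 + d)) := by gcongr
    _ = _ := by rw [mul_pow]

lemma le_choose_mul_pow (hs0 : 0 ≤ s) (hm : 2 * m ≤ n) :
    (n * s / 2) ^ m / m.factorial ≤ ((n - 1).choose m : ℝ) * s ^ m := by
  rcases Nat.eq_zero_or_pos m with rfl | hm0
  · simp
  have h1 := Nat.pow_le_choose (α := ℝ) m (n - 1)
  have h2 : (n / 2 : ℝ) ≤ ((n - 1 + 1 - m : ℕ) : ℝ) := by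
    rw [Nat.sub_add_cancel (by omega), Nat.cast_sub (by omega)]
    have : (2 * m : ℝ) ≤ n := by exact_mod_cast hm
    linarith
  calc _ = (n / 2 : ℝ) ^ m / m.factorial * s ^ m := by rw [div_pow, div_pow, mul_pow]; ring
    _ ≤ ((n - 1 + 1 - m : ℕ) : ℝ) ^ m / m.factorial * s ^ m := by gcongr
    _ ≤ _ := by gcongr

lemma exp_neg_le_one_sub_pow (hs1 : s ≤ 1 / 2) (n : ℕ) :
    Real.exp (-(n * s) - 2 * (n * s ^ 2)) ≤ (1 - s) ^ n := by
  have h1 : 0 < 1 - s := by linarith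
  have h2 := Real.one_sub_inv_le_log_of_pos h1
  have h3 : -s - 2 * s ^ 2 ≤ 1 - (1 - s)⁻¹ := by
    have : (1 - s)⁻¹ ≤ 1 + s + 2 * s ^ 2 := by
      rw [inv_le_iff_one_le_mul₀ h1]
      nlinarith [mul_nonneg (sq_nonneg s) (by linarith : 0 ≤ 1 - 2 * s)]
    linarith
  calc _ = Real.exp (-s - 2 * s ^ 2) ^ n := by rw [← Real.exp_nat_mul]; ring_nf
    _ ≤ Real.exp (Real.log (1 - s)) ^ n := by gcongr; linarith
    _ = _ := by rw [Real.exp_log h1]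

lemma sum_pow_mul_le {y : ℝ} (hy : 1 ≤ y) (m : ℕ) :
    (∑ l ∈ range m, (4 * y) ^ l) * y ≤ m * (4 * y) ^ m := by
  rw [sum_mul]
  calc _ ≤ ∑ l ∈ range m, (4 * y) ^ m := by
        refine sum_le_sum fun l hl => ?_
        calc (4 * y) ^ l * y ≤ (4 * y) ^ l * (4 * y) := by gcongr; linarith
          _ = (4 * y) ^ (l + 1) := by ring
          _ ≤ _ := pow_le_pow_right₀ (by linarith) (mem_range.1 hl)
    _ = _ := by simp

lemma pow_le_choose_mul_inclProb {q K P : ℕ} (hK : 2 * q ≤ K) (hKP : K ≤ P) :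
    ((K : ℝ) ^ 2 / P) ^ q ≤ 4 ^ q * q.factorial * (K.choose q * inclProb K P q) := by
  rcases Nat.eq_zero_or_pos q with rfl | hq
  · simp [inclProb]
  have h1 : (K / 2 : ℝ) ^ q / q.factorial ≤ K.choose q := by
    refine le_trans ?_ (Nat.pow_le_choose (α := ℝ) q K)
    have : (K / 2 : ℝ) ≤ ((K + 1 - q : ℕ) : ℝ) := by
      rw [Nat.cast_sub (by omega)]
      have : (2 * q : ℝ) ≤ K := by exact_mod_cast hK
      push_cast
      linarith
    gcongr
  have h2 : (P.choose q : ℝ) ≤ (P : ℝ) ^ q / q.factorial := Nat.choose_le_pow_div q P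
  have h3 : (0 : ℝ) < P.choose q := by exact_mod_cast Nat.choose_pos (by omega)
  have hP : (0 : ℝ) < P := by exact_mod_cast (by omega : 0 < P)
  have hf : (0 : ℝ) < q.factorial := by positivity
  unfold inclProb
  calc ((K : ℝ) ^ 2 / P) ^ q = 4 ^ q * q.factorial *
        ((K / 2 : ℝ) ^ q / q.factorial * ((K / 2 : ℝ) ^ q / q.factorial
          / ((P : ℝ) ^ q / q.factorial))) := by
        have : (4 : ℝ) ^ q = 2 ^ q * 2 ^ q := by rw [← mul_pow]; norm_num
        rw [this]
        simp only [div_pow, ← pow_mul]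
        field_simp
        ring
    _ ≤ _ := by gcongr

/-- Either the channel probability is small, or the rings are so sparse that the correlation
between two vertices is negligible. -/
lemma pow_correlation_le {q K P : ℕ} {p L : ℝ} (hq : 1 ≤ q) (hKP : K ≤ P)
    (hp : p ∈ Set.Ioc (0 : ℝ) 1) (hK : 32 * q ^ 2 ≤ K) (hx : (K : ℝ) ^ 2 / P ≤ 1 / 2)
    (hL : 0 < L) (hn : (n : ℝ) = Real.exp L) (hy : n * peq q K P p ≤ 2 * L) :
    (Real.exp (8 * q * p * (n * peq q K P p) / K) * ((K : ℝ) ^ 2 / P)) ^ q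
      ≤ Real.exp (16 * q) ^ q * ((K : ℝ) ^ 2 / P) ^ q
        + 4 ^ q * q.factorial * 4 * (L ^ 2 * Real.exp (-(L / 2))) := by
  have hp0 := hp.1
  have hpe0 := peq_nonneg (q := q) hKP hp
  have hK0 : 1 ≤ K := by nlinarith
  have hK1 : (1 : ℝ) ≤ K := by exact_mod_cast hK0
  have hK' : (32 * q ^ 2 : ℝ) ≤ K := by exact_mod_cast hK
  set x := (K : ℝ) ^ 2 / P with hxdef
  have hx0 : 0 ≤ x := by positivity
  rw [mul_pow]
  by_cases hpL : p * L ≤ 1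
  · refine le_add_of_le_of_nonneg ?_ (by positivity)
    gcongr
    rw [div_le_iff₀ (by linarith)]
    calc 8 * q * p * (n * peq q K P p) ≤ 8 * q * p * (2 * L) := by gcongr
      _ = 16 * q * (p * L) := by ring
      _ ≤ 16 * q * K := by gcongr; linarith
  · refine le_add_of_nonneg_of_le (by positivity) ?_
    push Not at hpL
    have hn0 : (0 : ℝ) < n := by rw [hn]; positivity
    have h1 : psq q K P ≤ 2 * L ^ 2 * Real.exp (-L) := by
      have h2 := psq_nonneg (q := q) hKP
      have h3 : psq q K P ≤ peq q K P p * L := by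
        unfold peq
        nlinarith
      have h4 : Real.exp (-L) = (n : ℝ)⁻¹ := by rw [Real.exp_neg, hn]
      rw [h4, ← div_eq_mul_inv, le_div_iff₀ hn0]
      nlinarith
    have h2 := le_psq hKP q
    have h3 := pow_le_choose_mul_inclProb (q := q) (K := K) (P := P) (by nlinarith) hKP
    have hM0 : 0 ≤ K.choose q * inclProb K P q := mul_nonneg (by positivity) (inclProb_nonneg _)
    have h4 : K.choose q * inclProb K P q ≤ 4 * (L ^ 2 * Real.exp (-L)) := by nlinarith
    have h5 : Real.exp (8 * q * p * (n * peq q K P p) / K) ^ q ≤ Real.exp (L / 2) := by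
      rw [← Real.exp_nat_mul]
      gcongr
      rw [mul_div_assoc', div_le_iff₀ (by linarith)]
      calc q * (8 * q * p * (n * peq q K P p)) ≤ q * (8 * q * 1 * (2 * L)) := by
            gcongr; exact hp.2
        _ = L / 2 * (32 * q ^ 2) := by ring
        _ ≤ _ := by gcongr
    calc _ ≤ Real.exp (L / 2) * (4 ^ q * q.factorial * (4 * (L ^ 2 * Real.exp (-L)))) := by
          gcongr
          exact h3.trans (by gcongr)
      _ = 4 ^ q * q.factorial * 4 * (L ^ 2 * (Real.exp (L / 2) * Real.exp (-L))) := by ring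
      _ = _ := by rw [← Real.exp_add]; ring_nf

end Estimates

section Asymptotics

variable {β s : ℕ → ℝ} {M : ℕ} {c : ℝ}

lemma tendsto_log_natCast : Tendsto (fun n : ℕ => Real.log n) atTop atTop :=
  Real.tendsto_log_atTop.comp tendsto_natCast_atTop_atTop

lemma tendsto_log_log_natCast : Tendsto (fun n : ℕ => Real.log (Real.log n)) atTop atTop :=
  Real.tendsto_log_atTop.comp tendsto_log_natCast

lemma eventually_mul_log_le (a : ℝ) : ∀ᶠ n : ℕ in atTop, a * Real.log (Real.log n) ≤ Real.log n := by
  have h := (Real.isLittleO_log_id_atTop.comp_tendsto tendsto_log_natCast).const_mul_left a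
  filter_upwards [h.bound one_pos, tendsto_log_natCast.eventually_ge_atTop 0] with n hn h0
  have := (le_abs_self _).trans hn
  simpa [abs_of_nonneg h0] using this

lemma tendsto_log_pow_div (k : ℕ) :
    Tendsto (fun n : ℕ => Real.log n ^ k / n) atTop (nhds 0) := by
  have h := (Real.tendsto_pow_mul_exp_neg_atTop_nhds_zero k).comp tendsto_log_natCast
  refine h.congr' ?_
  filter_upwards [eventually_gt_atTop 0] with n hn
  simp only [Function.comp]
  rw [Real.exp_neg, Real.exp_log (by exact_mod_cast hn), div_eq_mul_inv]

/-- The expected degree `n * s n` lies between `log n` and `2 * log n`. -/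
lemma eventually_mean_degree
    (hs : ∀ n : ℕ, s n = (Real.log n + M * Real.log (Real.log n) + β n) / n)
    (hβc : ∀ᶠ n : ℕ in atTop, β n ≤ c * Real.log (Real.log n)) (hβ : Tendsto β atTop atTop) :
    ∀ᶠ n : ℕ in atTop, n * s n = Real.log n + M * Real.log (Real.log n) + β n ∧
      Real.log n ≤ n * s n ∧ n * s n ≤ 2 * Real.log n := by
  filter_upwards [hβc, hβ.eventually_ge_atTop 0, eventually_mul_log_le (M + c),
    tendsto_log_log_natCast.eventually_ge_atTop 0, eventually_gt_atTop 0] with n h1 h2 h3 h4 h5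
  have e : n * s n = Real.log n + M * Real.log (Real.log n) + β n := by
    rw [hs]
    have : (n : ℝ) ≠ 0 := by positivity
    field_simp
  have : 0 ≤ M * Real.log (Real.log n) := by positivity
  exact ⟨e, by linarith, by linarith⟩

lemma tendsto_edge_prob (h : ∀ᶠ n : ℕ in atTop, Real.log n ≤ n * s n ∧ n * s n ≤ 2 * Real.log n) :
    Tendsto (fun n : ℕ => n * s n ^ 2) atTop (nhds 0) ∧ Tendsto s atTop (nhds 0) := by
  constructor
  · have h1 := (tendsto_log_pow_div 2).const_mul 4
    rw [mul_zero] at h1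
    refine squeeze_zero' (Eventually.of_forall fun n => by positivity) ?_ h1
    filter_upwards [h, eventually_gt_atTop 0, tendsto_log_natCast.eventually_ge_atTop 0]
      with n h2 h3 h4
    have h5 : (0 : ℝ) < n := by exact_mod_cast h3
    rw [mul_div_assoc', le_div_iff₀ h5]
    nlinarith
  · have h1 := (tendsto_log_pow_div 1).const_mul 2
    rw [mul_zero] at h1
    have h0 : ∀ᶠ n : ℕ in atTop, 0 ≤ s n ∧ s n ≤ 2 * (Real.log n ^ 1 / n) := by
      filter_upwards [h, eventually_gt_atTop 0, tendsto_log_natCast.eventually_ge_atTop 0]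
        with n h2 h3 h4
      have h5 : (0 : ℝ) < n := by exact_mod_cast h3
      refine ⟨by by_contra!; nlinarith, ?_⟩
      rw [mul_div_assoc', le_div_iff₀ h5]
      linarith
    exact squeeze_zero' (h0.mono fun n => And.left) (h0.mono fun n => And.right) h1

lemma mul_exp_neg_mean {n : ℕ} {y b : ℝ} (hn : 0 < n) (hL : 0 < Real.log n)
    (hy : y = Real.log n + M * Real.log (Real.log n) + b) :
    n * Real.exp (-y) * Real.log n ^ M = Real.exp (-b) := by
  have h1 : (n : ℝ) = Real.exp (Real.log n) := (Real.exp_log (by exact_mod_cast hn)).symm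
  have h2 : Real.log n ^ M = Real.exp (M * Real.log (Real.log n)) := by
    rw [Real.exp_nat_mul, Real.exp_log hL]
  rw [h2]
  nth_rewrite 1 [h1]
  rw [← Real.exp_add, ← Real.exp_add, hy]
  ring_nf

/-- Probability that a binomial variable with parameters `n - 1` and `s` equals `d`. -/
noncomputable def binomialMass (n : ℕ) (s : ℝ) (d : ℕ) : ℝ :=
  ((n - 1).choose d : ℝ) * s ^ d * (1 - s) ^ (n - 1 - d)

lemma tendsto_low_degree
    (h : ∀ᶠ n : ℕ in atTop, n * s n = Real.log n + M * Real.log (Real.log n) + β n ∧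
      Real.log n ≤ n * s n ∧ n * s n ≤ 2 * Real.log n)
    (hβ : Tendsto β atTop atTop) {d : ℕ} (hd : d ≤ M) :
    Tendsto (fun n : ℕ => n * binomialMass n (s n) d) atTop (nhds 0) := by
  have hs := (tendsto_edge_prob (h.mono fun n => And.right)).2
  have hlim : Tendsto (fun n => 2 ^ d * Real.exp (1 + d) * Real.exp (-β n)) atTop (nhds 0) := by
    have := (Real.tendsto_exp_neg_atTop_nhds_zero.comp hβ).const_mul (2 ^ d * Real.exp (1 + d))
    simpa [Function.comp_def] using this
  have key : ∀ᶠ n : ℕ in atTop, 0 ≤ n * binomialMass n (s n) d ∧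
      n * binomialMass n (s n) d ≤ 2 ^ d * Real.exp (1 + d) * Real.exp (-β n) := by
    filter_upwards [h, hs.eventually_le_const (zero_lt_one), eventually_ge_atTop (d + 1),
      tendsto_log_natCast.eventually_ge_atTop 1] with n h1 h2 h3 h4
    obtain ⟨h1, h5, h6⟩ := h1
    have hn : (0 : ℝ) < n := by exact_mod_cast (by omega : 0 < n)
    have hs0 : 0 ≤ s n := by by_contra!; nlinarith
    refine ⟨?_, ?_⟩
    · have : 0 ≤ 1 - s n := by linarith
      unfold binomialMass
      positivity
    rw [← mul_exp_neg_mean (by omega) (by linarith) h1]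
    calc n * binomialMass n (s n) d
        ≤ n * ((n * s n) ^ d * (Real.exp (-(n * s n)) * Real.exp (1 + d))) := by
          have := binomial_mass_le hs0 h2 h3
          unfold binomialMass
          gcongr
      _ ≤ n * ((2 ^ d * Real.log n ^ M) * (Real.exp (-(n * s n)) * Real.exp (1 + d))) := by
          gcongr
          calc (n * s n) ^ d ≤ (2 * Real.log n) ^ d := by gcongr
            _ = 2 ^ d * Real.log n ^ d := mul_pow _ _ _
            _ ≤ _ := by gcongr
      _ = _ := by ring
  exact squeeze_zero' (key.mono fun n => And.left) (key.mono fun n => And.right) hlim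

lemma tendsto_threshold_degree
    (h : ∀ᶠ n : ℕ in atTop, n * s n = Real.log n + M * Real.log (Real.log n) + β n ∧
      Real.log n ≤ n * s n ∧ n * s n ≤ 2 * Real.log n)
    (hβc : ∀ᶠ n : ℕ in atTop, β n ≤ c * Real.log (Real.log n)) (hc : c < 1) :
    Tendsto (fun n : ℕ => n * binomialMass n (s n) (M + 1)) atTop atTop := by
  obtain ⟨hs2, hs⟩ := tendsto_edge_prob (h.mono fun n => And.right)
  set C : ℝ := (1 / 2) ^ (M + 1) / (M + 1).factorial * Real.exp (-1) with hC
  have hC0 : 0 < C := by positivity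
  have hlim : Tendsto (fun n : ℕ => C * Real.exp ((1 - c) * Real.log (Real.log n))) atTop atTop :=
    (Real.tendsto_exp_atTop.comp
      (tendsto_log_log_natCast.const_mul_atTop (by linarith))).const_mul_atTop hC0
  refine tendsto_atTop_mono' _ ?_ hlim
  filter_upwards [h, hβc, hs.eventually_le_const (by norm_num : (0 : ℝ) < 1 / 2),
    eventually_ge_atTop (2 * (M + 1)), tendsto_log_natCast.eventually_ge_atTop 1,
    hs2.eventually_le_const (by norm_num : (0 : ℝ) < 1 / 2)] with n h1 h2 h3 h4 h5 h6
  obtain ⟨h1, h7, h8⟩ := h1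
  have hn : (0 : ℝ) < n := by exact_mod_cast (by omega : 0 < n)
  have hs0 : 0 ≤ s n := by by_contra!; nlinarith
  have h9 : Real.exp (-(n * s n)) * Real.exp (-1) ≤ (1 - s n) ^ (n - 1 - (M + 1)) := by
    calc _ ≤ Real.exp (-(n * s n) - 2 * (n * s n ^ 2)) := by
          rw [← Real.exp_add]; gcongr; linarith
      _ ≤ (1 - s n) ^ n := exp_neg_le_one_sub_pow h3 n
      _ ≤ _ := pow_le_pow_of_le_one (by linarith) (by linarith) (by omega)
  have h10 := le_choose_mul_pow (m := M + 1) hs0 h4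
  have h11 : (1 / 2 : ℝ) ^ (M + 1) * Real.log n ^ (M + 1) / (M + 1).factorial
      ≤ (n - 1).choose (M + 1) * s n ^ (M + 1) := by
    refine le_trans ?_ h10
    rw [← mul_pow]
    gcongr
    linarith
  have hL : Real.exp ((1 - c) * Real.log (Real.log n)) ≤ Real.log n * Real.exp (-β n) := by
    nth_rewrite 2 [← Real.exp_log (by linarith : 0 < Real.log n)]
    rw [← Real.exp_add]
    gcongr
    linarith
  calc C * Real.exp ((1 - c) * Real.log (Real.log n)) ≤ C * (Real.log n * Real.exp (-β n)) := by
        gcongr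
    _ = n * ((1 / 2 : ℝ) ^ (M + 1) * Real.log n ^ (M + 1) / (M + 1).factorial
          * (Real.exp (-(n * s n)) * Real.exp (-1))) := by
        rw [← mul_exp_neg_mean (by omega) (by linarith) h1, hC]
        ring
    _ ≤ n * binomialMass n (s n) (M + 1) := by
        unfold binomialMass
        gcongr

lemma tendsto_pair_ratio {B : ℕ → ℝ} (m : ℕ)
    (h : ∀ᶠ n : ℕ in atTop, Real.log n ≤ n * s n ∧ n * s n ≤ 2 * Real.log n)
    (hB : Tendsto B atTop (nhds 1)) :
    Tendsto (fun n : ℕ => (((n - 1).choose m : ℝ) ^ 2 * s n ^ (2 * m)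
        + ∑ l ∈ range (2 * m), (4 * n * s n) ^ l) * (B n * (1 - s n) ^ (2 * (n - 2 - 2 * m)))
        / binomialMass n (s n) m ^ 2) atTop (nhds 1) := by
  obtain ⟨hs2, hs⟩ := tendsto_edge_prob h
  set R : ℕ → ℝ := fun n => (∑ l ∈ range (2 * m), (4 * (n * s n)) ^ l)
    / ((n - 1).choose m * s n ^ m) ^ 2 with hR
  have hy : Tendsto (fun n : ℕ => n * s n) atTop atTop :=
    tendsto_atTop_mono' _ (h.mono fun n => And.left) tendsto_log_natCast
  have hR0 : Tendsto R atTop (nhds 0) := by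
    set D : ℝ := (2 * m : ℕ) * 4 ^ (2 * m) * 2 ^ (2 * m) * (m.factorial : ℝ) ^ 2 with hD
    have hlim : Tendsto (fun n : ℕ => D / (n * s n)) atTop (nhds 0) := hy.const_div_atTop D
    have key : ∀ᶠ n : ℕ in atTop, 0 ≤ R n ∧ R n ≤ D / (n * s n) := by
      filter_upwards [hy.eventually_ge_atTop 1, eventually_ge_atTop (2 * m), eventually_gt_atTop 0]
        with n h1 h2 h3
      have hn : (0 : ℝ) < n := by exact_mod_cast h3
      have hs0 : 0 < s n := by by_contra!; nlinarith
      refine ⟨by positivity, ?_⟩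
      have h4 := le_choose_mul_pow hs0.le h2
      have h5 := sum_pow_mul_le h1 (2 * m)
      have h6 : 0 < (n * s n / 2) ^ m / m.factorial := by positivity
      rw [le_div_iff₀ (by linarith)]
      calc R n * (n * s n) = ((∑ l ∈ range (2 * m), (4 * (n * s n)) ^ l) * (n * s n))
            / ((n - 1).choose m * s n ^ m) ^ 2 := by rw [hR]; ring
        _ ≤ ((2 * m : ℕ) * (4 * (n * s n)) ^ (2 * m)) / ((n * s n / 2) ^ m / m.factorial) ^ 2 := by
            gcongr
        _ = D := by
            rw [hD]
            simp only [div_pow, mul_pow, ← pow_mul, mul_comm m 2]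
            field_simp
    exact squeeze_zero' (key.mono fun n => And.left) (key.mono fun n => And.right) hlim
  have hlim : Tendsto (fun n => (1 + R n) * (B n * ((1 - s n) ^ (2 * (m + 1)))⁻¹)) atTop
      (nhds ((1 + 0) * (1 * ((1 - 0) ^ (2 * (m + 1)))⁻¹))) :=
    (hR0.const_add 1).mul (hB.mul (((hs.const_sub 1).pow _).inv₀ (by simp)))
  simp only [add_zero, sub_zero, one_pow, inv_one, mul_one] at hlim
  refine hlim.congr' ?_
  filter_upwards [hy.eventually_ge_atTop 1, eventually_ge_atTop (2 * m + 2),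
    hs.eventually_le_const (by norm_num : (0 : ℝ) < 1 / 2)] with n h1 h2 h3
  have hn : (0 : ℝ) < n := by exact_mod_cast (by omega : 0 < n)
  have hs0 : 0 < s n := by by_contra!; nlinarith
  have h4 : 0 < 1 - s n := by linarith
  have h5 : (0 : ℝ) < (n - 1).choose m := by exact_mod_cast Nat.choose_pos (by omega)
  have h6 : ((1 - s n) ^ (n - 1 - m)) ^ 2
      = (1 - s n) ^ (2 * (n - 2 - 2 * m)) * (1 - s n) ^ (2 * (m + 1)) := by
    rw [← pow_mul, ← pow_add]
    congr 1
    omega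
  have h7 : ∀ l, (4 * n * s n) ^ l = (4 * (n * s n)) ^ l := fun l => by rw [mul_assoc]
  simp_rw [h7]
  unfold binomialMass
  rw [mul_pow, h6, hR]
  simp only [mul_comm 2 m, pow_mul]
  field_simp

lemma tendsto_correlation {q : ℕ} (hq : 1 ≤ q) {K P : ℕ → ℕ} {p : ℕ → ℝ} (hKP : ∀ n, K n ≤ P n)
    (hp : ∀ n, p n ∈ Set.Ioc (0 : ℝ) 1) (hKinf : Tendsto (fun n => (K n : ℝ)) atTop atTop)
    (hKsqP : Tendsto (fun n => (K n : ℝ) ^ 2 / (P n : ℝ)) atTop (nhds 0))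
    (h : ∀ᶠ n : ℕ in atTop, n * peq q (K n) (P n) (p n) ≤ 2 * Real.log n) :
    Tendsto (fun n : ℕ => Real.exp (8 * q * p n * (n * peq q (K n) (P n) (p n)) / K n)
      * ((K n : ℝ) ^ 2 / P n)) atTop (nhds 0) := by
  set F : ℕ → ℝ := fun n => Real.exp (8 * q * p n * (n * peq q (K n) (P n) (p n)) / K n)
      * ((K n : ℝ) ^ 2 / P n) with hF
  have hF0 : ∀ n, 0 ≤ F n := fun n => by positivity
  have hq0 : q ≠ 0 := by omega
  have hpow : Tendsto (fun n => F n ^ q) atTop (nhds 0) := by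
    have l1 : Tendsto (fun n : ℕ => Real.log n ^ 2 * Real.exp (-(Real.log n / 2))) atTop
        (nhds 0) := by
      have := (((Real.tendsto_pow_mul_exp_neg_atTop_nhds_zero 2).comp
        (tendsto_log_natCast.atTop_div_const two_pos))).const_mul 4
      rw [mul_zero] at this
      refine this.congr fun n => ?_
      simp only [Function.comp]
      ring
    have l2 := ((hKsqP.pow q).const_mul (Real.exp (16 * q) ^ q)).add
      (l1.const_mul (4 ^ q * (q.factorial : ℝ) * 4))
    rw [zero_pow hq0, mul_zero, mul_zero, add_zero] at l2
    refine squeeze_zero' (Eventually.of_forall fun n => pow_nonneg (hF0 n) q) ?_ l2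
    filter_upwards [h, hKinf.eventually_ge_atTop (32 * q ^ 2 : ℕ),
      hKsqP.eventually_le_const (by norm_num : (0 : ℝ) < 1 / 2), eventually_gt_atTop 0,
      tendsto_log_natCast.eventually_gt_atTop 0] with n h1 h2 h3 h4 h5
    exact pow_correlation_le hq (hKP n) (hp n) (by exact_mod_cast h2) h3 h5
      (Real.exp_log (by exact_mod_cast h4)).symm h1
  have h2 := hpow.rpow_const (p := (q : ℝ)⁻¹) (Or.inr (by positivity))
  rw [Real.zero_rpow (by positivity)] at h2
  exact h2.congr fun n => Real.pow_rpow_inv_natCast (hF0 n) hq0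

end Asymptotics

/-- under the fine-grained scaling
`p_{e,q}(n) = (ln n + (k−1) ln ln n + b ln ln n + β_n)/n` with `k + b ≥ 1` and
`−1 < liminf β_n/ln ln n ≤ limsup β_n/ln ln n < 1` (i.e.,
`c₁ ln ln n ≤ β_n ≤ c₂ ln ln n` eventually, for constants `−1 < c₁ ≤ c₂ < 1`),
if `β_n → +∞` then `P[min degree = k+b] → 1`. -/
theorem min_degree_eq_kb_prob_one
    (q : ℕ) (hq : 1 ≤ q) (k : ℕ) (hk : 1 ≤ k) (b : ℤ)
    (K P : ℕ → ℕ) (p : ℕ → ℝ) (β : ℕ → ℝ)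
    (c₁ c₂ : ℝ) (hc₁ : -1 < c₁) (hc₁₂ : c₁ ≤ c₂) (hc₂ : c₂ < 1)
    (hK1 : ∀ n, 1 ≤ K n) (hKP : ∀ n, K n ≤ P n)
    (hp : ∀ n, p n ∈ Set.Ioc (0 : ℝ) 1)
    (hKinf : Tendsto (fun n => (K n : ℝ)) atTop atTop)
    (hKsqP : Tendsto (fun n => ((K n : ℝ)) ^ 2 / (P n : ℝ)) atTop (nhds 0))
    (hpe : ∀ n : ℕ, peq q (K n) (P n) (p n)
      = (Real.log (n : ℝ) + ((k : ℝ) - 1) * Real.log (Real.log (n : ℝ))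
          + (b : ℝ) * Real.log (Real.log (n : ℝ)) + β n) / (n : ℝ))
    (hβbound : ∀ᶠ (n : ℕ) in atTop,
      c₁ * Real.log (Real.log (n : ℝ)) ≤ β n ∧ β n ≤ c₂ * Real.log (Real.log (n : ℝ)))
    (hkb : 1 ≤ (k : ℤ) + b) (hβ : Tendsto β atTop atTop) :
    Tendsto (fun n => prob n (K n) (P n) (p n)
        {ω | (minDeg q n (P n) ω : ℤ) = (k : ℤ) + b})
      atTop (nhds 1) := by

  obtain ⟨M, hM⟩ : ∃ M : ℕ, (k : ℤ) + b = (M + 1 : ℕ) :=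
    ⟨((k : ℤ) + b - 1).toNat, by push_cast; omega⟩
  set s : ℕ → ℝ := fun n => peq q (K n) (P n) (p n) with hs
  have hsM : ∀ n : ℕ, s n = (Real.log n + M * Real.log (Real.log n) + β n) / n := by
    intro n
    have : (k : ℝ) + b = M + 1 := by exact_mod_cast hM
    rw [hs]
    simp only
    rw [hpe, show (M : ℝ) = k - 1 + b by linarith]
    ring
  have hβc := hβbound.mono fun n => And.right
  have hmean := eventually_mean_degree hsM hβc hβ
  have hmean' := hmean.mono fun n => And.right
  obtain ⟨hs2, hs0⟩ := tendsto_edge_prob hmean'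
  have hcorr := tendsto_correlation hq hKP hp hKinf hKsqP (hmean'.mono fun n => And.right)
  have hB : Tendsto (fun n : ℕ => Real.exp (16 * n * s n ^ 2
      + (Real.exp (8 * q * p n * (n * s n) / K n) - 1) * ((K n : ℝ) ^ 2 / P n))) atTop
      (nhds 1) := by
    have := ((hs2.const_mul 16).add (hcorr.sub hKsqP)).rexp
    rw [mul_zero, sub_zero, add_zero, Real.exp_zero] at this
    refine this.congr fun n => ?_
    congr 1
    ring
  have hlow : Tendsto (fun n : ℕ => ∑ d ∈ range (M + 1), n * binomialMass n (s n) d) atTop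
      (nhds 0) := by
    rw [← sum_const_zero (s := range (M + 1))]
    exact tendsto_finsetSum _ fun d hd =>
      tendsto_low_degree hmean hβ (Nat.lt_succ_iff.1 (mem_range.1 hd))
  have hthr := tendsto_threshold_degree hmean hβc hc₂
  have hratio := tendsto_pair_ratio (M + 1) hmean' hB
  have hlim := (hlow.const_sub 1).sub ((hthr.inv_tendsto_atTop.add hratio).sub_const 1)
  rw [zero_add, sub_self, sub_zero, sub_zero] at hlim
  refine tendsto_of_tendsto_of_tendsto_of_le_of_le' hlim tendsto_const_nhds ?_
    (Eventually.of_forall fun n => prob_le_one (hp n) (hKP n) _)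
  filter_upwards [hthr.eventually_gt_atTop 0, eventually_ge_atTop (2 * (M + 1) + 2),
    hKsqP.eventually_le_const (by norm_num : (0 : ℝ) < 1 / 2),
    hs0.eventually_le_const (by norm_num : (0 : ℝ) < 1 / 2)] with n h1 h2 h3 h4
  have hs0 : 0 ≤ s n := peq_nonneg (hKP n) (hp n)
  have h5 : 0 ≤ 1 - s n := by linarith
  have := one_le_prob_minDeg_add (q := q) (m := M + 1) (g := binomialMass n (s n)) (hp n) (hKP n)
    (by omega) (fun i d => graphE_degree (hKP n) i d)
    (pos_of_mul_pos_right h1 (by positivity))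
    (fun i j hij => graphE_degree_pair_le (hp n) (hKP n) (hK1 n) hq h3 h4 h2 hij)
    (by positivity)
  simp only [hM, Nat.cast_inj]
  simp only [Pi.inv_apply]
  linarith
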